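/- arXiv:1201.5593 — 8 statements merged into one kernel-verified Lean document; each statement's English description precedes it below -/
import Mathlib

section
/- Let N ∈ ℕ and let a_0 ≤ a_1 ≤ … ≤ a_N be natural numbers such that a_0 < a_2 < a_4 < … and a_1 < a_3 < a_5 < …. Let 𝒥 = {i ∈ {0,…,N} : the value a_i occurs exactly once in the list a_0,…,a_N}. Then |𝒥| ≡ N+1 (mod 2); moreover, writing 𝒥 = {i_0 < i_1 < … < i_μ}, we have i_s ≡ s (mod 2) for all 0 ≤ s ≤ μ, so each difference i_{s+1} − i_s is odd. In particular, if N is even then 𝒥 is nonempty of odd cardinality 2M+1 for some M ∈ ℕ. -/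
theorem le_of_step_le {N : ℕ} {a : ℕ → ℕ} (hmono : ∀ i, i + 1 ≤ N → a i ≤ a (i + 1))
    {i j : ℕ} (hij : i ≤ j) (hj : j ≤ N) : a i ≤ a j := by
  induction j, hij using Nat.le_induction with
  | base => exact le_rfl
  | succ j _ ih => exact (ih (by lia)).trans (hmono j hj)

/-- Equal values of the sequence can only occur at consecutive indices. -/
theorem le_succ_of_eq {N : ℕ} {a : ℕ → ℕ} (hmono : ∀ i, i + 1 ≤ N → a i ≤ a (i + 1))
    (hstrict : ∀ i, i + 2 ≤ N → a i < a (i + 2)) {i j : ℕ} (hj : j ≤ N) (h : a i = a j) :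
    j ≤ i + 1 := by
  by_contra! hij
  have h₁ := hstrict i (by lia)
  have h₂ := le_of_step_le hmono (show i + 2 ≤ j by lia) hj
  lia

theorem card_filter_eq_one_iff {N : ℕ} {a : ℕ → ℕ}
    (hmono : ∀ i, i + 1 ≤ N → a i ≤ a (i + 1))
    (hstrict : ∀ i, i + 2 ≤ N → a i < a (i + 2)) {i : ℕ} (hi : i ≤ N) :
    ((Finset.range (N + 1)).filter fun j => a j = a i).card = 1 ↔
      (0 < i → a (i - 1) ≠ a i) ∧ (i < N → a i ≠ a (i + 1)) := by
  rw [Finset.card_eq_one]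
  constructor
  · rintro ⟨x, hx⟩
    have key : ∀ j, j ≤ N → a j = a i → j = x := fun j hj h => by
      have : j ∈ (Finset.range (N + 1)).filter fun j => a j = a i := by
        simp [h, Nat.lt_succ_of_le hj]
      simpa [hx] using this
    have hix := key i hi rfl
    refine ⟨fun h h' => ?_, fun h h' => ?_⟩
    · have := key (i - 1) (by lia) h'
      lia
    · have := key (i + 1) h h'.symm
      lia
  · rintro ⟨hl, hr⟩
    refine ⟨i, Finset.ext fun j => ?_⟩
    simp only [Finset.mem_filter, Finset.mem_range, Finset.mem_singleton]
    refine ⟨fun ⟨hj, h⟩ => ?_, fun h => by subst h; exact ⟨by lia, rfl⟩⟩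
    have h₁ := le_succ_of_eq hmono hstrict (Nat.le_of_lt_succ hj) h.symm
    have h₂ := le_succ_of_eq hmono hstrict hi h
    by_contra hne
    rcases Nat.lt_or_gt_of_ne hne with hlt | hlt
    · obtain rfl : i = j + 1 := by lia
      exact hl (by lia) h
    · obtain rfl : j = i + 1 := by lia
      exact hr (by lia) h.symm

/-- The number of singly occurring indices below `k` has the parity of `k`, unless `k` is the
second index of a pair of equal values. -/
theorem card_filter_lt_mod_two {N : ℕ} {a : ℕ → ℕ}
    (hstrict : ∀ i, i + 2 ≤ N → a i < a (i + 2)) {J : Finset ℕ}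
    (hJ : ∀ i, i ∈ J ↔ i ≤ N ∧ (0 < i → a (i - 1) ≠ a i) ∧ (i < N → a i ≠ a (i + 1)))
    (k : ℕ) (hk : k ≤ N + 1) :
    (J.filter (· < k)).card % 2 =
      (if 0 < k ∧ k ≤ N ∧ a (k - 1) = a k then k + 1 else k) % 2 := by
  induction k with
  | zero => simp
  | succ k ih =>
    have ih := ih (by lia)
    have hJk := hJ k
    have hs := hstrict (k - 1)
    clear hJ hstrict
    by_cases hkJ : k ∈ J
    · have : J.filter (· < k + 1) = insert k (J.filter (· < k)) := by
        ext x
        simp only [Finset.mem_filter, Finset.mem_insert]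
        grind
      rw [this, Finset.card_insert_of_notMem (by simp)]
      grind
    · have : J.filter (· < k + 1) = J.filter (· < k) := by
        ext x
        simp only [Finset.mem_filter]
        grind
      rw [this]
      grind

theorem card_filter_lt_orderEmbOfFin (J : Finset ℕ) (s : Fin J.card) :
    (J.filter (· < J.orderEmbOfFin rfl s)).card = s := by
  have : J.filter (· < J.orderEmbOfFin rfl s) =
      (Finset.Iio s).map (J.orderEmbOfFin rfl).toEmbedding := by
    ext x
    simp only [Finset.mem_filter, Finset.mem_map, Finset.mem_Iio, RelEmbedding.coe_toEmbedding]
    constructor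
    · rintro ⟨hx, hlt⟩
      rw [← Finset.mem_coe, ← J.range_orderEmbOfFin rfl] at hx
      obtain ⟨t, rfl⟩ := hx
      exact ⟨t, (J.orderEmbOfFin rfl).lt_iff_lt.1 hlt, rfl⟩
    · rintro ⟨t, ht, rfl⟩
      exact ⟨J.orderEmbOfFin_mem rfl t, (J.orderEmbOfFin rfl).lt_iff_lt.2 ht⟩
  rw [this, Finset.card_map, Fin.card_Iio]

/-- Let `a_0 ≤ a_1 ≤ … ≤ a_N` be natural numbers whose even-indexed and
odd-indexed subsequences are strictly increasing.  Let `J` be the set of indices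
`i ∈ {0,…,N}` such that the value `a i` occurs exactly once in `a_0,…,a_N`.
Then `|J| ≡ N+1 (mod 2)`; enumerating `J = {i_0 < i_1 < … < i_μ}` we have
`i_s ≡ s (mod 2)` for all `s`, so each difference `i_{s+1} - i_s` is odd; in
particular if `N` is even then `J` is nonempty of odd cardinality `2M+1`. -/
theorem stmt_0 (N : ℕ) (a : ℕ → ℕ)
    (hmono : ∀ i, i + 1 ≤ N → a i ≤ a (i + 1))
    (hstrict : ∀ i, i + 2 ≤ N → a i < a (i + 2))
    (J : Finset ℕ)
    (hJ : J = (Finset.range (N + 1)).filter fun i =>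
      ((Finset.range (N + 1)).filter fun j => a j = a i).card = 1) :
    J.card % 2 = (N + 1) % 2
    ∧ (∀ s : Fin J.card, ((J.orderEmbOfFin rfl s : ℕ)) % 2 = (s : ℕ) % 2)
    ∧ (∀ s : Fin J.card, ∀ h : (s : ℕ) + 1 < J.card,
        Odd ((J.orderEmbOfFin rfl ⟨(s : ℕ) + 1, h⟩ : ℕ) - (J.orderEmbOfFin rfl s : ℕ)))
    ∧ (Even N → ∃ M : ℕ, J.card = 2 * M + 1) := by
  have hmem : ∀ i, i ∈ J ↔
      i ≤ N ∧ (0 < i → a (i - 1) ≠ a i) ∧ (i < N → a i ≠ a (i + 1)) := fun i => by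
    rw [hJ, Finset.mem_filter, Finset.mem_range, Nat.lt_succ_iff]
    exact and_congr_right fun hi => card_filter_eq_one_iff hmono hstrict hi
  have hcard : J.card % 2 = (N + 1) % 2 := by
    have h := card_filter_lt_mod_two hstrict hmem (N + 1) le_rfl
    rw [Finset.filter_true_of_mem fun x hx => Nat.lt_succ_of_le ((hmem x).1 hx).1] at h
    rwa [if_neg (by lia)] at h
  have hpar (s : Fin J.card) : (J.orderEmbOfFin rfl s : ℕ) % 2 = (s : ℕ) % 2 := by
    obtain ⟨hN, hl, -⟩ := (hmem _).1 (J.orderEmbOfFin_mem rfl s)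
    have h := card_filter_lt_mod_two hstrict hmem (J.orderEmbOfFin rfl s) (by lia)
    rw [card_filter_lt_orderEmbOfFin, if_neg fun h => hl h.1 h.2.2] at h
    exact h.symm
  refine ⟨hcard, hpar, fun s h => ?_, fun ⟨m, hm⟩ => ⟨J.card / 2, by lia⟩⟩
  have hlt : J.orderEmbOfFin rfl s < J.orderEmbOfFin rfl ⟨s + 1, h⟩ :=
    (J.orderEmbOfFin rfl).lt_iff_lt.2 (Fin.lt_def.2 (Nat.lt_succ_self _))
  have h₁ := hpar s
  have h₂ := hpar ⟨s + 1, h⟩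
  rw [Nat.odd_iff]
  dsimp only at h₂
  lia
end

section
/- In Setup (§1): for every subset X ⊆ {1,3,…,2M−1}, the sequence a^X belongs to ℰ, and the multiset [â^X] = {â^X_0,…,â^X_N} equals the multiset [â] = {â_0,…,â_N}. -/
theorem Multiset.map_range_eq_of_pairwise_swap {α : Type*} {f g : ℕ → α} (n : ℕ) (h0 : f 0 = g 0)
    (h : ∀ j < n, (f (2 * j + 1) = g (2 * j + 1) ∧ f (2 * j + 2) = g (2 * j + 2)) ∨
      (f (2 * j + 1) = g (2 * j + 2) ∧ f (2 * j + 2) = g (2 * j + 1))) :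
    (Multiset.range (2 * n + 1)).map f = (Multiset.range (2 * n + 1)).map g := by
  induction n with
  | zero => simp [h0]
  | succ n ih =>
    rw [show 2 * (n + 1) + 1 = 2 * n + 1 + 1 + 1 by ring, Multiset.range_succ,
      Multiset.range_succ]
    simp only [Multiset.map_cons]
    rw [ih fun j hj => h j (by omega)]
    rcases h n (by omega) with ⟨h1, h2⟩ | ⟨h1, h2⟩
    · rw [h1, h2]
    · rw [h1, h2, Multiset.cons_swap]

/-- The values of a monotone sequence before its first unrepeated entry come in equal consecutive
pairs, provided no value occurs three times. -/
theorem even_of_first_unrepeated {N c : ℕ} {a : ℕ → ℕ}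
    (hle : ∀ i j, i ≤ j → j ≤ N → a i ≤ a j)
    (hstrict : ∀ i, i + 2 ≤ N → a i < a (i + 2))
    (hc : c ≤ N) (hsingle : ∀ j ≤ N, a j = a c → j = c)
    (hfirst : ∀ i < c, ∃ j ≤ N, a j = a i ∧ j ≠ i) : Even c := by
  have pair (j : ℕ) (hj : 2 * j < c) (hlt : ∀ i < 2 * j, a i < a (2 * j)) :
      a (2 * j + 1) = a (2 * j) := by
    obtain ⟨l, hl, hal, hne⟩ := hfirst _ hj
    have h1 : ¬ l < 2 * j := fun h => (hlt l h).ne hal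
    have h2 := hle (2 * j + 1) l (by omega) hl
    have h3 := hle (2 * j) (2 * j + 1) (by omega) (by omega)
    omega
  have before (j : ℕ) (hj : 2 * j ≤ c) : ∀ i < 2 * j, a i < a (2 * j) := by
    induction j with
    | zero => intro i hi; omega
    | succ j ih =>
      intro i hi
      have h1 := pair j (by omega) (ih (by omega))
      have h2 := hstrict (2 * j) (by omega)
      have h3 := hle i (2 * j + 1) (by omega) (by omega)
      rw [show 2 * (j + 1) = 2 * j + 2 by ring]
      omega
  by_contra hodd
  obtain ⟨j, rfl⟩ := Nat.not_even_iff_odd.mp hodd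
  have := hsingle (2 * j) (by omega) (pair j (by omega) (before j (by omega))).symm
  omega


/-- Setup §1: for every subset `X ⊆ {1,3,…,2M-1}`, the sequence `a^X`
(characterized by swapping adjacent pairs inside the blocks `[i_s, i_{s+1}]` for
`s ∈ X` and leaving all other entries unchanged) belongs to `ℰ`, and the multiset
`[â^X]` equals the multiset `[â]`, where `b̂_i = b_i + ⌈i/2⌉`. -/
theorem stmt_1 (N M : ℕ) (a I m : ℕ → ℕ)
    (hN : Even N)
    (hmono : ∀ i, i + 1 ≤ N → a i ≤ a (i + 1))
    (hstrict : ∀ i, i + 2 ≤ N → a i < a (i + 2))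
    -- `I 0 < I 1 < … < I (2M)` enumerates the set `𝒥` of indices `i ≤ N` such
    -- that the value `a i` occurs exactly once in `a_0,…,a_N`:
    (hImono : ∀ s t, s < t → t ≤ 2 * M → I s < I t)
    (hIJ : ∀ i, (i ≤ N ∧ ((Finset.range (N + 1)).filter fun j => a j = a i).card = 1)
        ↔ ∃ s, s ≤ 2 * M ∧ I s = i)
    (hm : ∀ s, s < 2 * M → I (s + 1) = I s + 2 * m s + 1)
    -- `X ⊆ {1,3,…,2M-1}`:
    (X : Finset ℕ) (hX : ∀ s ∈ X, s % 2 = 1 ∧ s < 2 * M)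
    -- `aX` is the sequence `a^X`:
    (aX : ℕ → ℕ)
    (haX : ∀ s ∈ X, ∀ k ≤ m s, aX (I s + 2 * k) = a (I s + 2 * k + 1)
        ∧ aX (I s + 2 * k + 1) = a (I s + 2 * k))
    (haX' : ∀ i ≤ N, (∀ s ∈ X, ¬ (I s ≤ i ∧ i ≤ I s + 2 * m s + 1)) → aX i = a i) :
    -- `a^X ∈ ℰ`:
    ((∀ i, i + 2 ≤ N → aX i < aX (i + 2))
      ∧ (Multiset.range (N + 1)).map aX = (Multiset.range (N + 1)).map a)
    -- `[â^X] = [â]`: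
    ∧ (Multiset.range (N + 1)).map (fun i => aX i + (i + 1) / 2)
        = (Multiset.range (N + 1)).map (fun i => a i + (i + 1) / 2) := by
  have hle : ∀ i j, i ≤ j → j ≤ N → a i ≤ a j := by
    intro i j hij
    induction j, hij using Nat.le_induction with
    | base => exact fun _ => le_rfl
    | succ j _ ih => exact fun hj => (ih (by omega)).trans (hmono j hj)
  have hIle : ∀ s ≤ 2 * M, I s ≤ N := fun s hs => ((hIJ (I s)).mpr ⟨s, hs, rfl⟩).1
  have hsingle : ∀ s ≤ 2 * M, ∀ j ≤ N, a j = a (I s) → j = I s := by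
    intro s hs j hj haj
    have hcard := ((hIJ (I s)).mpr ⟨s, hs, rfl⟩).2
    refine Finset.card_le_one.mp hcard.le j ?_ (I s) ?_
    · simpa [Nat.lt_succ_iff] using ⟨hj, haj⟩
    · simpa [Nat.lt_succ_iff] using hIle s hs
  have hfirst : ∀ i < I 0, ∃ j ≤ N, a j = a i ∧ j ≠ i := by
    intro i hi
    have hiN : i ≤ N := hi.le.trans (hIle 0 (by omega))
    by_contra! hno
    obtain ⟨s, hs, hsi⟩ := (hIJ i).mp ⟨hiN, by
      rw [Finset.card_eq_one]
      refine ⟨i, Finset.ext fun j => ?_⟩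
      simp only [Finset.mem_filter, Finset.mem_range, Finset.mem_singleton]
      refine ⟨fun h => hno j (by omega) h.2, ?_⟩
      rintro rfl
      exact ⟨by omega, rfl⟩⟩
    rcases Nat.eq_zero_or_pos s with rfl | hpos
    · omega
    · have := hImono 0 s hpos hs
      omega
  have hI0 : Even (I 0) :=
    even_of_first_unrepeated hle hstrict (hIle 0 (by omega)) (hsingle 0 (by omega)) hfirst
  have hpar : ∀ s ≤ 2 * M, I s % 2 = s % 2 := by
    intro s
    induction s with
    | zero => intro _; simpa using Nat.even_iff.mp hI0
    | succ s ih =>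
      intro hs
      have h1 := ih (by omega)
      have h2 := hm s (by omega)
      omega
  let S : ℕ → Prop := fun p => ∃ s ∈ X, ∃ k ≤ m s, p = I s + 2 * k
  have swap : ∀ p, S p → aX p = a (p + 1) ∧ aX (p + 1) = a p := by
    rintro p ⟨s, hs, k, hk, rfl⟩
    exact haX s hs k hk
  have fix_odd : ∀ p ≤ N, p % 2 = 1 → ¬ S p → aX p = a p := by
    intro p hp hodd hS
    refine haX' p hp fun s hs hblock => hS ⟨s, hs, (p - I s) / 2, ?_, ?_⟩ <;>
    · have := hpar s (hX s hs).2.le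
      have := (hX s hs).1
      omega
  have fix_even : ∀ p, p + 1 ≤ N → p % 2 = 1 → ¬ S p → aX (p + 1) = a (p + 1) := by
    intro p hp hodd hS
    refine haX' (p + 1) hp fun s hs hblock => hS ⟨s, hs, (p - I s) / 2, ?_, ?_⟩ <;>
    · have := hpar s (hX s hs).2.le
      have := (hX s hs).1
      omega
  have fix_zero : aX 0 = a 0 := by
    refine haX' 0 (Nat.zero_le _) fun s hs hblock => ?_
    have := hpar s (hX s hs).2.le
    have := (hX s hs).1
    omega
  have block_end : ∀ p, p + 2 ≤ N → S p → ¬ S (p + 2) → a (p + 1) < a (p + 2) := by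
    rintro p hp ⟨s, hs, k, hk, rfl⟩ hS
    have hkm : k = m s := by
      by_contra hne
      exact hS ⟨s, hs, k + 1, by omega, by ring⟩
    subst hkm
    have hs' := (hX s hs).2
    refine lt_of_le_of_ne (hmono _ hp) fun heq => ?_
    have hI := hm s hs'
    have := hsingle (s + 1) (by omega) _ hp (by rw [hI]; exact heq.symm)
    omega
  have block_start : ∀ i, i + 1 ≤ N → S (i + 1) → (∀ p, i = p + 1 → ¬ S p) →
      a i < a (i + 1) := by
    rintro i hi ⟨s, hs, k, hk, hik⟩ hS
    have hk0 : k = 0 := by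
      by_contra hne
      exact hS (i - 1) (by omega) ⟨s, hs, k - 1, by omega, by omega⟩
    subst hk0
    refine lt_of_le_of_ne (hmono i hi) fun heq => ?_
    have := hsingle s (hX s hs).2.le i (by omega) (by rw [heq, hik]; rfl)
    omega
  have pairs : ∀ n, N = 2 * n → ∀ j < n,
      (aX (2 * j + 1) = a (2 * j + 1) ∧ aX (2 * j + 2) = a (2 * j + 2)) ∨
      (aX (2 * j + 1) = a (2 * j + 2) ∧ aX (2 * j + 2) = a (2 * j + 1)) := by
    intro n hn j hj
    by_cases hS : S (2 * j + 1)
    · exact Or.inr (swap _ hS)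
    · exact Or.inl ⟨fix_odd _ (by omega) (by omega) hS, fix_even _ (by omega) (by omega) hS⟩
  obtain ⟨n, hn⟩ := hN.two_dvd
  have hpairs := pairs n hn
  refine ⟨⟨fun i hi => ?_, ?_⟩, ?_⟩
  · have hlt := hstrict i hi
    rcases Nat.mod_two_eq_zero_or_one i with hpi | hpi
    · have hlast : (S (i + 1) ∧ aX (i + 2) = a (i + 1)) ∨ aX (i + 2) = a (i + 2) := by
        by_cases h : S (i + 1)
        · exact Or.inl ⟨h, (swap _ h).2⟩
        · exact Or.inr (fix_even _ hi (by omega) h)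
      rcases i with _ | p
      · rw [fix_zero]
        rcases hlast with ⟨h, e⟩ | e
        · rw [e]
          exact block_start 0 (by omega) h (by omega)
        · rwa [e]
      · by_cases hp : S p
        · rw [(swap p hp).2]
          have h1 := hstrict p (by omega)
          have h2 := hmono (p + 1) (by omega)
          rcases hlast with ⟨_, e⟩ | e <;> rw [e]
          · exact h1
          · exact (hmono p (by omega)).trans_lt hlt
        · rw [fix_even p (by omega) (by omega) hp]
          rcases hlast with ⟨h, e⟩ | e
          · rw [e]
            refine block_start (p + 1) (by omega) h fun q hq => ?_
            rwa [← Nat.succ.inj hq]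
          · rwa [e]
    · by_cases hp : S i <;> by_cases hq : S (i + 2)
      · rw [(swap _ hp).1, (swap _ hq).1]
        have hq' : i + 3 ≤ N := by omega
        exact hstrict (i + 1) hq'
      · rw [(swap _ hp).1, fix_odd _ hi (by omega) hq]
        exact block_end i hi hp hq
      · rw [fix_odd i (by omega) hpi hp, (swap _ hq).1]
        exact hlt.trans_le (hmono (i + 2) (by omega))
      · rwa [fix_odd i (by omega) hpi hp, fix_odd _ hi (by omega) hq]
  · rw [hn]
    exact Multiset.map_range_eq_of_pairwise_swap n fix_zero hpairs
  · rw [hn]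
    refine Multiset.map_range_eq_of_pairwise_swap n (by simp [fix_zero]) fun j hj => ?_
    have := hpairs j hj
    omega
end

section
/- (Lemma 1.2) In Setup (§1): if b ∈ ℰ satisfies [b̂] = [â] as multisets, then b = a^X for some subset X ⊆ {1,3,…,2M−1}. -/
/-- If `b` is increasing along steps of two and takes the same values as the nondecreasing `a` on
`[2j+1, 2j+2n]`, also after adding `⌈i/2⌉`, then `b` agrees with `a` up to swaps of the pairs
`(2i+1, 2i+2)`. -/
theorem pair_eq_or_swap_of_range' (a b : ℕ → ℕ) (n j N : ℕ) (hN : 2 * (j + n) = N)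
    (hmono : ∀ i, i + 1 ≤ N → a i ≤ a (i + 1))
    (hb : ∀ i, i + 2 ≤ N → b i < b (i + 2))
    (h : Multiset.map b (List.range' (2 * j + 1) (2 * n)) =
      Multiset.map a (List.range' (2 * j + 1) (2 * n)))
    (hhat : Multiset.map (fun i => b i + (i + 1) / 2) (List.range' (2 * j + 1) (2 * n)) =
      Multiset.map (fun i => a i + (i + 1) / 2) (List.range' (2 * j + 1) (2 * n)))
    (i : ℕ) (hji : j ≤ i) (hi : i < j + n) :
    (b (2 * i + 1) = a (2 * i + 1) ∧ b (2 * i + 2) = a (2 * i + 2)) ∨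
      (b (2 * i + 1) = a (2 * i + 2) ∧ b (2 * i + 2) = a (2 * i + 1)) := by
  induction n generalizing j with
  | zero => omega
  | succ n ih =>
    have hmono' : ∀ k l, k ≤ l → l ≤ N → a k ≤ a l := by
      intro k l hkl
      induction l, hkl using Nat.le_induction with
      | base => intro; rfl
      | succ l hkl ihl => intro hl; exact (ihl (by omega)).trans (hmono l hl)
    have e : List.range' (2 * j + 1) (2 * (n + 1)) =
        (2 * j + 1) :: (2 * j + 2) :: List.range' (2 * (j + 1) + 1) (2 * n) := rfl
    have e₁ : (2 * j + 1 + 1) / 2 = j + 1 := by omega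
    have e₂ : (2 * j + 2 + 1) / 2 = j + 1 := by omega
    rw [e] at h hhat
    simp only [← Multiset.cons_coe, Multiset.map_cons, e₁, e₂] at h hhat
    set R : Multiset ℕ := (List.range' (2 * (j + 1) + 1) (2 * n) : Multiset ℕ) with hR
    have memR : ∀ k, k ∈ R ↔ 2 * j + 3 ≤ k ∧ k ≤ N := by
      intro k
      rw [hR, Multiset.mem_coe, List.mem_range'_1]
      omega
    have key : (b (2 * j + 1) = a (2 * j + 1) ∧ b (2 * j + 2) = a (2 * j + 2)) ∨
        (b (2 * j + 1) = a (2 * j + 2) ∧ b (2 * j + 2) = a (2 * j + 1)) := by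
      have lower : ∀ x, x ∈ a (2 * j + 1) ::ₘ a (2 * j + 2) ::ₘ R.map a → a (2 * j + 1) ≤ x := by
        intro x hx
        simp only [Multiset.mem_cons, Multiset.mem_map] at hx
        rcases hx with rfl | rfl | ⟨k, hk, rfl⟩
        · rfl
        · exact hmono' _ _ (by omega) (by omega)
        · rw [memR] at hk
          exact hmono' _ _ (by omega) (by omega)
      have lower₂ : ∀ x, x ∈ a (2 * j + 2) ::ₘ R.map a → a (2 * j + 2) ≤ x := by
        intro x hx
        simp only [Multiset.mem_cons, Multiset.mem_map] at hx
        rcases hx with rfl | ⟨k, hk, rfl⟩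
        · rfl
        · rw [memR] at hk
          exact hmono' _ _ (by omega) (by omega)
      have lowb : ∀ k, 2 * j + 1 ≤ k → k ≤ N → a (2 * j + 1) ≤ b k := by
        intro k hk hk'
        apply lower
        rw [← h]
        rcases (by omega : k = 2 * j + 1 ∨ k = 2 * j + 2 ∨ 2 * j + 3 ≤ k) with rfl | rfl | hk''
        · simp
        · simp
        · exact Multiset.mem_cons_of_mem (Multiset.mem_cons_of_mem
            (Multiset.mem_map_of_mem b ((memR k).2 ⟨hk'', hk'⟩)))
      have hmin : b (2 * j + 1) = a (2 * j + 1) ∨ b (2 * j + 2) = a (2 * j + 1) := by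
        have hx : a (2 * j + 1) ∈ b (2 * j + 1) ::ₘ b (2 * j + 2) ::ₘ R.map b := by
          rw [h]; simp
        simp only [Multiset.mem_cons, Multiset.mem_map] at hx
        rcases hx with hx | hx | ⟨k, hk, hx⟩
        · exact Or.inl hx.symm
        · exact Or.inr hx.symm
        · rw [memR] at hk
          have h₁ := hb (k - 2) (by omega)
          rw [Nat.sub_add_cancel (by omega)] at h₁
          have h₂ := lowb (k - 2) (by omega) (by omega)
          omega
      have finish : ∀ x, x ::ₘ R.map b = a (2 * j + 2) ::ₘ R.map a →
          (x + (j + 1)) ::ₘ R.map (fun i => b i + (i + 1) / 2) =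
            (a (2 * j + 2) + (j + 1)) ::ₘ R.map (fun i => a i + (i + 1) / 2) →
          x = a (2 * j + 2) := by
        intro x hx hxhat
        have hy : a (2 * j + 2) + (j + 1) ∈
            (x + (j + 1)) ::ₘ R.map (fun i => b i + (i + 1) / 2) := by
          rw [hxhat]; simp
        simp only [Multiset.mem_cons, Multiset.mem_map] at hy
        rcases hy with hy | ⟨k, hk, hy⟩
        · omega
        · have h₁ := lower₂ (b k) (by
            rw [← hx]; exact Multiset.mem_cons_of_mem (Multiset.mem_map_of_mem b hk))
          rw [memR] at hk
          omega
      rcases hmin with hmin | hmin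
      · rw [hmin] at h hhat
        exact Or.inl ⟨hmin, finish _ ((Multiset.cons_inj_right _).1 h)
          ((Multiset.cons_inj_right _).1 hhat)⟩
      · rw [hmin, Multiset.cons_swap] at h hhat
        exact Or.inr ⟨finish _ ((Multiset.cons_inj_right _).1 h)
          ((Multiset.cons_inj_right _).1 hhat), hmin⟩
    rcases hji.eq_or_lt with rfl | hlt
    · exact key
    · refine ih (j + 1) (by omega) ?_ ?_ hlt (by omega)
      · rcases key with ⟨k₁, k₂⟩ | ⟨k₁, k₂⟩
        · rw [k₁, k₂] at h
          exact (Multiset.cons_inj_right _).1 ((Multiset.cons_inj_right _).1 h)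
        · rw [k₁, k₂, Multiset.cons_swap] at h
          exact (Multiset.cons_inj_right _).1 ((Multiset.cons_inj_right _).1 h)
      · rcases key with ⟨k₁, k₂⟩ | ⟨k₁, k₂⟩
        · rw [k₁, k₂] at hhat
          exact (Multiset.cons_inj_right _).1 ((Multiset.cons_inj_right _).1 hhat)
        · rw [k₁, k₂, Multiset.cons_swap] at hhat
          exact (Multiset.cons_inj_right _).1 ((Multiset.cons_inj_right _).1 hhat)

/-- Lemma 1.2, Setup §1: if `b ∈ ℰ` satisfies `[b̂] = [â]` as
multisets (where `b̂_i = b_i + ⌈i/2⌉`), then `b = a^X` for some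
`X ⊆ {1,3,…,2M-1}`, i.e. `b` is obtained from `a` by swapping the adjacent
pairs inside the blocks `[i_s, i_{s+1}]` for `s ∈ X` and agrees with `a`
everywhere else. -/
theorem stmt_2 (N M : ℕ) (a I m : ℕ → ℕ)
    (hN : Even N)
    (hmono : ∀ i, i + 1 ≤ N → a i ≤ a (i + 1))
    (hstrict : ∀ i, i + 2 ≤ N → a i < a (i + 2))
    (hImono : ∀ s t, s < t → t ≤ 2 * M → I s < I t)
    (hIJ : ∀ i, (i ≤ N ∧ ((Finset.range (N + 1)).filter fun j => a j = a i).card = 1)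
        ↔ ∃ s, s ≤ 2 * M ∧ I s = i)
    (hm : ∀ s, s < 2 * M → I (s + 1) = I s + 2 * m s + 1)
    -- `b ∈ ℰ`:
    (b : ℕ → ℕ)
    (hbstrict : ∀ i, i + 2 ≤ N → b i < b (i + 2))
    (hbmult : (Multiset.range (N + 1)).map b = (Multiset.range (N + 1)).map a)
    -- `[b̂] = [â]`:
    (hbhat : (Multiset.range (N + 1)).map (fun i => b i + (i + 1) / 2)
        = (Multiset.range (N + 1)).map (fun i => a i + (i + 1) / 2)) :
    ∃ X : Finset ℕ, (∀ s ∈ X, s % 2 = 1 ∧ s < 2 * M)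
      ∧ (∀ s ∈ X, ∀ k ≤ m s, b (I s + 2 * k) = a (I s + 2 * k + 1)
          ∧ b (I s + 2 * k + 1) = a (I s + 2 * k))
      ∧ (∀ i ≤ N, (∀ s ∈ X, ¬ (I s ≤ i ∧ i ≤ I s + 2 * m s + 1)) → b i = a i) := by
  obtain ⟨K, hK⟩ := hN
  have hle : ∀ k l, k ≤ l → l ≤ N → a k ≤ a l := by
    intro k l hkl
    induction l, hkl using Nat.le_induction with
    | base => intro; rfl
    | succ l hkl ihl => intro hl; exact (ihl (by omega)).trans (hmono l hl)
  have e : Multiset.range (N + 1) = 0 ::ₘ (List.range' (2 * 0 + 1) (2 * K) : Multiset ℕ) := by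
    rw [Multiset.cons_coe, Multiset.range, List.range_eq_range', hK, ← two_mul]
    rfl
  have hb0 : b 0 = a 0 := by
    have h₀ : ∀ k ≤ N, a 0 ≤ b k := by
      intro k hk
      have hx : b k ∈ (Multiset.range (N + 1)).map a := by
        rw [← hbmult]
        exact Multiset.mem_map_of_mem b (Multiset.mem_range.2 (by omega))
      obtain ⟨l, hl, hx⟩ := Multiset.mem_map.1 hx
      rw [Multiset.mem_range] at hl
      rw [← hx]
      exact hle _ _ (by omega) (by omega)
    have hx : a 0 + (0 + 1) / 2 ∈ (Multiset.range (N + 1)).map (fun i => b i + (i + 1) / 2) := by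
      rw [hbhat]
      exact Multiset.mem_map_of_mem (fun i => a i + (i + 1) / 2) (Multiset.mem_range.2 (by omega))
    obtain ⟨l, hl, hx⟩ := Multiset.mem_map.1 hx
    rw [Multiset.mem_range] at hl
    have := h₀ l (by omega)
    obtain rfl : l = 0 := by omega
    omega
  rw [e] at hbmult hbhat
  simp only [Multiset.map_cons, hb0] at hbmult hbhat
  have pair := fun i hi => pair_eq_or_swap_of_range' a b K 0 N (by omega) hmono hbstrict
    ((Multiset.cons_inj_right _).1 hbmult) ((Multiset.cons_inj_right _).1 hbhat) i (Nat.zero_le _) hi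
  have single_iff : ∀ i, i ≤ N → ((∃ s, s ≤ 2 * M ∧ I s = i) ↔
      (∀ k ≤ N, a k = a i → k = i)) := by
    intro i hi
    rw [← hIJ, Finset.card_eq_one]
    constructor
    · rintro ⟨-, x, hx⟩ k hk hak
      have h₁ : i ∈ ({x} : Finset ℕ) := by rw [← hx]; simp; omega
      have h₂ : k ∈ ({x} : Finset ℕ) := by rw [← hx]; simp; omega
      simp only [Finset.mem_singleton] at h₁ h₂
      omega
    · intro h
      refine ⟨hi, i, ?_⟩
      ext k
      simp only [Finset.mem_filter, Finset.mem_range, Finset.mem_singleton]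
      constructor
      · rintro ⟨hk, hak⟩
        exact h k (by omega) hak
      · rintro rfl
        exact ⟨by omega, rfl⟩
  have I_le : ∀ s, s ≤ 2 * M → I s ≤ N := fun s hs => ((hIJ (I s)).2 ⟨s, hs, rfl⟩).1
  have I_single : ∀ s, s ≤ 2 * M → ∀ k ≤ N, a k = a (I s) → k = I s := fun s hs =>
    (single_iff (I s) (I_le s hs)).1 ⟨s, hs, rfl⟩
  have not_single : ∀ i, i ≤ N → (¬ ∃ s, s ≤ 2 * M ∧ I s = i) →
      (1 ≤ i ∧ a (i - 1) = a i) ∨ (i + 1 ≤ N ∧ a (i + 1) = a i) := by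
    intro i hi h
    rw [single_iff i hi] at h
    push Not at h
    obtain ⟨k, hk, hak, hne⟩ := h
    rcases lt_or_gt_of_ne hne with hlt | hgt
    · left
      have h₁ := hle k (i - 1) (by omega) (by omega)
      have h₂ := hle (i - 1) i (by omega) (by omega)
      exact ⟨by omega, by omega⟩
    · right
      have h₁ := hle i (i + 1) (by omega) (by omega)
      have h₂ := hle (i + 1) k (by omega) (by omega)
      exact ⟨by omega, by omega⟩
  have gap : ∀ s, s < 2 * M → ∀ i, I s < i → i < I (s + 1) → ¬ ∃ t, t ≤ 2 * M ∧ I t = i := by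
    rintro s hs i h₁ h₂ ⟨t, ht, rfl⟩
    rcases lt_trichotomy t s with h | h | h
    · have := hImono t s h (by omega)
      omega
    · subst h; omega
    · rcases (by omega : t = s + 1 ∨ s + 1 < t) with h | h
      · subst h; omega
      · have := hImono (s + 1) t h ht
        omega
  have I_zero : I 0 % 2 = 0 := by
    by_contra hodd
    have hI0 := I_le 0 (Nat.zero_le _)
    have chain : ∀ k, 2 * k < I 0 → a (2 * k + 1) = a (2 * k) := by
      intro k
      induction k with
      | zero =>
        intro hk
        rcases not_single 0 (by omega) (by
          rintro ⟨t, ht, h0⟩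
          rcases Nat.eq_zero_or_pos t with rfl | hpos
          · omega
          · have := hImono 0 t hpos ht
            omega) with h | h
        · omega
        · exact h.2
      | succ k ih =>
        intro hk
        have h₁ := ih (by omega)
        have h₂ := hstrict (2 * k) (by omega)
        rcases not_single (2 * (k + 1)) (by omega) (by
          rintro ⟨t, ht, h0⟩
          rcases Nat.eq_zero_or_pos t with rfl | hpos
          · omega
          · have := hImono 0 t hpos ht
            omega) with h | h
        · have h₃ := h.2
          rw [show 2 * (k + 1) - 1 = 2 * k + 1 by omega, show 2 * (k + 1) = 2 * k + 2 by ring] at h₃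
          omega
        · exact h.2
    have h₁ := chain (I 0 / 2) (by omega)
    rw [show 2 * (I 0 / 2) + 1 = I 0 by omega] at h₁
    have := I_single 0 (Nat.zero_le _) (2 * (I 0 / 2)) (by omega) h₁.symm
    omega
  have I_parity : ∀ s, s ≤ 2 * M → I s % 2 = s % 2 := by
    intro s
    induction s with
    | zero => intro; omega
    | succ s ih =>
      intro hs
      have h₁ := ih (by omega)
      have h₂ := hm s (by omega)
      omega
  refine ⟨(Finset.range (2 * M)).filter fun s => s % 2 = 1 ∧ b (I s) ≠ a (I s), ?_, ?_, ?_⟩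
  · intro s hs
    simp only [Finset.mem_filter, Finset.mem_range] at hs
    exact ⟨hs.2.1, hs.1⟩
  · intro s hs k
    simp only [Finset.mem_filter, Finset.mem_range] at hs
    obtain ⟨hsM, hs2, hne⟩ := hs
    have hpar := I_parity s hsM.le
    have hms := hm s hsM
    have hN' := I_le (s + 1) (by omega)
    have link : ∀ k, k < m s → a (I s + 2 * k + 2) = a (I s + 2 * k + 1) := by
      intro k
      induction k with
      | zero =>
        intro hk
        rcases not_single (I s + 1) (by omega) (gap s hsM _ (by omega) (by omega)) with h | h
        · have h₁ := I_single s hsM.le (I s + 1) (by omega) h.2.symm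
          omega
        · exact h.2
      | succ k ih =>
        intro hk
        have h₁ := ih (by omega)
        have h₂ := hstrict (I s + 2 * k + 1) (by omega)
        rcases not_single (I s + 2 * (k + 1) + 1) (by omega)
          (gap s hsM _ (by omega) (by omega)) with h | h
        · have h₃ := h.2
          rw [show I s + 2 * (k + 1) + 1 - 1 = I s + 2 * k + 2 by omega,
            show I s + 2 * (k + 1) + 1 = I s + 2 * k + 1 + 2 by ring] at h₃
          omega
        · exact h.2
    induction k with
    | zero =>
      intro _
      have hp := pair (I s / 2) (by omega)
      rw [show 2 * (I s / 2) + 2 = I s + 1 by omega, show 2 * (I s / 2) + 1 = I s by omega] at hp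
      rcases hp with hp | hp
      · exact absurd hp.1 hne
      · exact hp
    | succ k ih =>
      intro hk
      have h₁ := ih (by omega)
      have h₂ := link k (by omega)
      have h₃ := hbstrict (I s + 2 * k) (by omega)
      have hp := pair (I s / 2 + k + 1) (by omega)
      rw [show 2 * (I s / 2 + k + 1) + 2 = I s + 2 * (k + 1) + 1 by omega,
        show 2 * (I s / 2 + k + 1) + 1 = I s + 2 * (k + 1) by omega] at hp
      rcases hp with hp | hp
      · have h₄ := hp.1
        rw [show I s + 2 * (k + 1) = I s + 2 * k + 2 by ring] at h₄
        omega
      · exact hp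
  · intro i hi hX
    by_contra hne
    have hi0 : i ≠ 0 := by
      rintro rfl
      exact hne hb0
    obtain ⟨j, hj⟩ : ∃ j, i = 2 * j + 1 ∨ i = 2 * j + 2 := ⟨(i - 1) / 2, by omega⟩
    have hjK : j < 0 + K := by omega
    have hswap : a (2 * j + 1) < a (2 * j + 2) ∧ b (2 * j + 1) = a (2 * j + 2) ∧
        b (2 * j + 2) = a (2 * j + 1) := by
      have h₁ := hmono (2 * j + 1) (by omega)
      rcases pair j hjK with hp | hp
      · rcases hj with rfl | rfl
        · exact absurd hp.1 hne
        · exact absurd hp.2 hne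
      · refine ⟨lt_of_le_of_ne h₁ fun heq => hne ?_, hp⟩
        rcases hj with rfl | rfl <;> omega
    -- the last unrepeated position before the pair
    have left : ∀ j, j < 0 + K → a (2 * j + 1) < a (2 * j + 2) → b (2 * j + 1) = a (2 * j + 2) →
        b (2 * j + 2) = a (2 * j + 1) →
        ∃ s, s ≤ 2 * M ∧ I s ≤ 2 * j + 1 ∧ I s % 2 = 1 ∧ b (I s) ≠ a (I s) ∧
          ∀ k, I s < k → k ≤ 2 * j + 1 → ¬ ∃ t, t ≤ 2 * M ∧ I t = k := by
      intro j
      induction j with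
      | zero =>
        intro hj h₁ h₂ h₃
        by_cases hs : ∃ s, s ≤ 2 * M ∧ I s = 2 * 0 + 1
        · obtain ⟨s, hs, hIs⟩ := hs
          exact ⟨s, hs, by omega, by omega, by rw [hIs]; omega, by omega⟩
        · rcases not_single _ (by omega) hs with h | h
          · have h₄ := hbstrict 0 (by omega)
            have h₅ := h.2
            simp only [mul_zero, zero_add, Nat.sub_self] at *
            omega
          · have h₅ := h.2
            rw [show 2 * 0 + 1 + 1 = 2 * 0 + 2 by ring] at h₅
            omega
      | succ j ih =>
        intro hj h₁ h₂ h₃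
        by_cases hs : ∃ s, s ≤ 2 * M ∧ I s = 2 * (j + 1) + 1
        · obtain ⟨s, hs, hIs⟩ := hs
          exact ⟨s, hs, by omega, by omega, by rw [hIs]; omega, by omega⟩
        · rcases not_single _ (by omega) hs with h | h
          · have h₅ := h.2
            have h₆ := hstrict (2 * j + 1) (by omega)
            have h₇ := hbstrict (2 * j + 2) (by omega)
            rw [show 2 * (j + 1) + 1 - 1 = 2 * j + 2 by omega] at h₅
            rw [show 2 * j + 1 + 2 = 2 * (j + 1) + 1 by ring] at h₆
            rw [show 2 * j + 2 + 2 = 2 * (j + 1) + 2 by ring] at h₇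
            have hp := pair j (by omega)
            obtain ⟨s, g₁, g₂, g₃, g₄, g₅⟩ := ih (by omega) (by omega) (by omega) (by omega)
            refine ⟨s, g₁, by omega, g₃, g₄, fun k hk hk' => ?_⟩
            rcases (by omega : k ≤ 2 * j + 1 ∨ k = 2 * j + 2 ∨ k = 2 * (j + 1) + 1) with
              hk | rfl | rfl
            · exact g₅ k ‹_› hk
            · intro ht
              have := (single_iff _ (by omega)).1 ht (2 * (j + 1) + 1) (by omega) h₅.symm
              omega
            · exact hs
          · have h₅ := h.2
            rw [show 2 * (j + 1) + 1 + 1 = 2 * (j + 1) + 2 by ring] at h₅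
            omega
    obtain ⟨s, hs, hsj, hodd, hbs, hgap⟩ := left j hjK hswap.1 hswap.2.1 hswap.2.2
    have hpar := I_parity s hs
    have hms := hm s (by omega)
    have hsucc : ¬ I (s + 1) ≤ 2 * j + 1 := fun hle' =>
      hgap (I (s + 1)) (by omega) hle' ⟨s + 1, by omega, rfl⟩
    refine hX s ?_ (by omega)
    simp only [Finset.mem_filter, Finset.mem_range]
    exact ⟨by omega, by omega, hbs⟩
end

section
/- In Setup (§2): every b ∈ ℰ satisfies b_i = a_i for all indices i < i_0 and all indices i > i_μ (where i_0 and i_μ are the smallest and largest elements of 𝒥). -/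
open Finset in
/-- The number of indices in `{0, …, N}` at which `f` takes the value `v`. -/
def valueCount {α : Type*} [DecidableEq α] (N : ℕ) (f : ℕ → α) (v : α) : ℕ :=
  #{j ∈ range (N + 1) | f j = v}

theorem valueCount_pos {α : Type*} [DecidableEq α] {N i : ℕ} (f : ℕ → α) (hi : i ≤ N) :
    0 < valueCount N f (f i) :=
  Finset.card_pos.2 ⟨i, by simp; omega⟩

theorem valueCount_reflect {α : Type*} [DecidableEq α] (N : ℕ) (f : ℕ → α) (v : α) :
    valueCount N (fun i => f (N - i)) v = valueCount N f v := by
  unfold valueCount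
  refine Finset.card_nbij' (N - ·) (N - ·) ?_ ?_ ?_ ?_
  · intro i hi
    simp only [Finset.coe_filter, Finset.mem_range, Set.mem_ofPred_eq] at hi ⊢
    exact ⟨by omega, hi.2⟩
  · intro i hi
    simp only [Finset.coe_filter, Finset.mem_range, Set.mem_ofPred_eq] at hi ⊢
    exact ⟨by omega, by rw [show N - (N - i) = i by omega]; exact hi.2⟩
  all_goals
    intro i hi
    simp only [Finset.coe_filter, Finset.mem_range, Set.mem_ofPred_eq] at hi
    dsimp only
    omega

theorem valueCount_eq_of_map_eq {α : Type*} [DecidableEq α] {N : ℕ} {f g : ℕ → α}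
    (h : (Multiset.range (N + 1)).map f = (Multiset.range (N + 1)).map g) (v : α) :
    valueCount N f v = valueCount N g v := by
  have key (k : ℕ → α) : valueCount N k v = ((Multiset.range (N + 1)).map k).count v := by
    simp only [valueCount, Multiset.count_map, Finset.card_def, Finset.filter_val,
      Finset.range_val, eq_comm]
  rw [key, key, h]

theorem le_of_step_le_s3 {α : Type*} [Preorder α] {N : ℕ} {f : ℕ → α}
    (hf : ∀ i, i + 1 ≤ N → f i ≤ f (i + 1)) {i j : ℕ} (hij : i ≤ j) (hj : j ≤ N) :
    f i ≤ f j := by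
  induction j, hij using Nat.le_induction with
  | base => exact le_rfl
  | succ j _ ih => exact (ih (by omega)).trans (hf j hj)

theorem lt_of_two_step_lt {α : Type*} [Preorder α] {N : ℕ} {f : ℕ → α}
    (hf : ∀ i, i + 2 ≤ N → f i < f (i + 2)) {i j : ℕ} (hij : i < j) (hpar : i % 2 = j % 2)
    (hj : j ≤ N) : f i < f j := by
  obtain ⟨k, rfl⟩ : ∃ k, j = i + 2 * k + 2 := ⟨(j - i) / 2 - 1, by omega⟩
  clear hij hpar
  induction k with
  | zero => exact hf i hj
  | succ k ih => exact (ih (by omega)).trans (hf (i + 2 * k + 2) hj)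

/-- A value attained at least twice by a function strictly increasing on each parity class is
attained on both parity classes. -/
theorem exists_parity_of_two_le_valueCount {α : Type*} [LinearOrder α] {N : ℕ} {f : ℕ → α}
    (hf : ∀ i, i + 2 ≤ N → f i < f (i + 2)) {v : α} (hv : 2 ≤ valueCount N f v) (i : ℕ) :
    ∃ p ≤ N, p % 2 = i % 2 ∧ f p = v := by
  obtain ⟨x, hx, y, hy, hxy⟩ := Finset.one_lt_card.1 hv
  simp only [Finset.mem_filter, Finset.mem_range] at hx hy
  have hpar : x % 2 ≠ y % 2 := by
    intro h
    rcases hxy.lt_or_gt with hlt | hlt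
    · exact (lt_of_two_step_lt hf hlt h (by omega)).ne (hx.2.trans hy.2.symm)
    · exact (lt_of_two_step_lt hf hlt h.symm (by omega)).ne (hy.2.trans hx.2.symm)
  by_cases h : x % 2 = i % 2
  · exact ⟨x, by omega, h, hx.2⟩
  · exact ⟨y, by omega, by omega, hy.2⟩

/-- On an initial segment where every value of the nondecreasing function `a` is repeated, a
rearrangement `b` of `a` that is strictly increasing on each parity class agrees with `a`. -/
theorem eq_of_lt_of_repeated {α : Type*} [LinearOrder α] {N n : ℕ} {a b : ℕ → α}
    (hmono : ∀ i, i + 1 ≤ N → a i ≤ a (i + 1))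
    (ha : ∀ i, i + 2 ≤ N → a i < a (i + 2))
    (hb : ∀ i, i + 2 ≤ N → b i < b (i + 2))
    (hcount : ∀ v, valueCount N b v = valueCount N a v)
    (hn : n ≤ N + 1) (hrep : ∀ i < n, 2 ≤ valueCount N a (a i)) :
    ∀ i < n, b i = a i := by
  intro i
  induction i using Nat.strong_induction_on with
  | _ i ih =>
  intro hi
  apply le_antisymm
  · obtain ⟨p, hpN, hpar, hp⟩ :=
      exists_parity_of_two_le_valueCount hb ((hrep i hi).trans_eq (hcount _).symm) i
    rcases lt_trichotomy p i with h | rfl | h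
    · have := lt_of_two_step_lt ha h hpar (by omega)
      exact absurd ((ih p h (by omega)).symm.trans hp) this.ne
    · exact hp.le
    · exact hp ▸ (lt_of_two_step_lt hb h hpar.symm hpN).le
  · by_contra! hlt
    have hsub : insert i {j ∈ Finset.range (N + 1) | a j = b i} ⊆
        {j ∈ Finset.range (N + 1) | b j = b i} := by
      intro j hj
      simp only [Finset.mem_insert, Finset.mem_filter, Finset.mem_range] at hj ⊢
      rcases hj with rfl | ⟨hjN, hj⟩
      · exact ⟨by omega, rfl⟩
      · have hji : j < i := by
          by_contra! h
          exact absurd (le_of_step_le_s3 hmono h (by omega)) (not_le.2 (hj ▸ hlt))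
        exact ⟨hjN, (ih j hji (by omega)).trans hj⟩
    have hcard := Finset.card_le_card hsub
    rw [Finset.card_insert_of_notMem (by simp [hlt.ne'])] at hcard
    have := hcount (b i)
    simp only [valueCount] at this
    omega


/-- Setup §2: every `b ∈ ℰ` satisfies `b_i = a_i` for all indices
`i < i_0` and all indices `i > i_μ` (where `i_0 = I 0` and `i_μ = I μ` are the
smallest and largest elements of the set `𝒥` of indices whose value occurs
exactly once in `a`). -/
theorem stmt_3 (N μ : ℕ) (a I : ℕ → ℕ)
    (hmono : ∀ i, i + 1 ≤ N → a i ≤ a (i + 1))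
    (hstrict : ∀ i, i + 2 ≤ N → a i < a (i + 2))
    -- `I 0 < I 1 < … < I μ` enumerates the (nonempty) set `𝒥`:
    (hImono : ∀ s t, s < t → t ≤ μ → I s < I t)
    (hIJ : ∀ i, (i ≤ N ∧ ((Finset.range (N + 1)).filter fun j => a j = a i).card = 1)
        ↔ ∃ s, s ≤ μ ∧ I s = i)
    -- `b ∈ ℰ`:
    (b : ℕ → ℕ)
    (hbstrict : ∀ i, i + 2 ≤ N → b i < b (i + 2))
    (hbmult : (Multiset.range (N + 1)).map b = (Multiset.range (N + 1)).map a) :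
    (∀ i, i < I 0 → b i = a i) ∧ (∀ i, I μ < i → i ≤ N → b i = a i) := by
  obtain ⟨hIN, -⟩ := (hIJ (I μ)).2 ⟨μ, le_rfl, rfl⟩
  obtain ⟨hI0N, -⟩ := (hIJ (I 0)).2 ⟨0, μ.zero_le, rfl⟩
  have hI {s t : ℕ} (hst : s ≤ t) (ht : t ≤ μ) : I s ≤ I t := by
    rcases hst.eq_or_lt with rfl | h
    · exact le_rfl
    · exact (hImono s t h ht).le
  have hrep {i : ℕ} (hi : i ≤ N) (h : ∀ s ≤ μ, I s ≠ i) : 2 ≤ valueCount N a (a i) := by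
    have hne : valueCount N a (a i) ≠ 1 := by
      intro h1
      obtain ⟨s, hs, hsi⟩ := (hIJ i).1 ⟨hi, h1⟩
      exact h s hs hsi
    have := valueCount_pos a hi
    omega
  have hcount := valueCount_eq_of_map_eq hbmult
  refine ⟨eq_of_lt_of_repeated hmono hstrict hbstrict hcount (by omega) fun i hi =>
    hrep (by omega) fun s hs => ((hi.trans_le (hI s.zero_le hs)).ne'), fun i hi hiN => ?_⟩
  have hrefl := eq_of_lt_of_repeated (N := N) (n := N - I μ)
    (a := fun i => OrderDual.toDual (a (N - i))) (b := fun i => OrderDual.toDual (b (N - i)))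
    (fun i hi => by
      have := hmono (N - (i + 1)) (by omega)
      rw [show N - (i + 1) + 1 = N - i by omega] at this
      exact this)
    (fun i hi => by
      have := hstrict (N - (i + 2)) (by omega)
      rw [show N - (i + 2) + 2 = N - i by omega] at this
      exact this)
    (fun i hi => by
      have := hbstrict (N - (i + 2)) (by omega)
      rw [show N - (i + 2) + 2 = N - i by omega] at this
      exact this)
    (fun v => (valueCount_reflect N b v.ofDual).trans
      ((hcount _).trans (valueCount_reflect N a v.ofDual).symm))
    (by omega)
    (fun i hi => (hrep (i := N - i) (by omega) fun s hs => by
      have := hI hs le_rfl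
      omega).trans_eq (valueCount_reflect N a (a (N - i))).symm)
    (N - i) (by omega)
  have hrefl' : b (N - (N - i)) = a (N - (N - i)) := hrefl
  rwa [show N - (N - i) = i by omega] at hrefl'
end

section
/- In Setup (§1): assume M ≥ 1 and let b ∈ ℰ satisfy [b̂] = [â] as multisets. Then exactly one of the following holds on the block of indices [i_{2M−1}, i_{2M}]: either b_i = a_i for all i ∈ [i_{2M−1}, i_{2M}], or b_{i_{2M−1}+2k} = a_{i_{2M−1}+2k+1} and b_{i_{2M−1}+2k+1} = a_{i_{2M−1}+2k} for all 0 ≤ k ≤ m_{2M−1}. -/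
theorem Multiset.map_range_eq_of_eq_above {f g : ℕ → ℕ} {k : ℕ} (n : ℕ)
    (h : (Multiset.range (k + n)).map f = (Multiset.range (k + n)).map g)
    (hfg : ∀ i, k ≤ i → i < k + n → f i = g i) :
    (Multiset.range k).map f = (Multiset.range k).map g := by
  induction n with
  | zero => exact h
  | succ n ih =>
    rw [← Nat.add_assoc, Multiset.range_succ, Multiset.map_cons, Multiset.map_cons,
      hfg (k + n) (by omega) (by omega), Multiset.cons_inj_right] at h
    exact ih h fun i h1 h2 => hfg i h1 (by omega)

theorem exists_eq_of_map_range_eq {f g : ℕ → ℕ} {n i : ℕ}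
    (h : (Multiset.range n).map f = (Multiset.range n).map g) (hi : i < n) :
    ∃ j < n, g j = f i := by
  have : f i ∈ (Multiset.range n).map g :=
    h ▸ Multiset.mem_map_of_mem f (Multiset.mem_range.2 hi)
  simpa using this

theorem Multiset.map_range_comp_of_involutive {σ : ℕ → ℕ} {n : ℕ} (hσ : Function.Involutive σ)
    (hn : ∀ i < n, σ i < n) (f : ℕ → ℕ) :
    (Multiset.range n).map (fun i => f (σ i)) = (Multiset.range n).map f := by
  have h : (Multiset.range n).map σ = Multiset.range n := by
    refine (Multiset.Nodup.ext ((Multiset.nodup_range n).map hσ.injective)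
      (Multiset.nodup_range n)).2 fun x => ?_
    simp only [Multiset.mem_map, Multiset.mem_range]
    constructor
    · rintro ⟨y, hy, rfl⟩
      exact hn y hy
    · intro hx
      exact ⟨σ x, hn x hx, hσ x⟩
  conv_rhs => rw [← h, Multiset.map_map]
  rfl

/-- If the two largest values of `a` on `[0, p + 1]` coincide and are attained at the end, then a
rearrangement `c` whose maximum is only attained at the last two places agrees with `a` there. -/
theorem eq_of_top_pair {a c : ℕ → ℕ} {p : ℕ}
    (h : (Multiset.range (p + 2)).map c = (Multiset.range (p + 2)).map a)
    (hp : a p = a (p + 1)) (ha : ∀ i ≤ p + 1, a i ≤ a (p + 1))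
    (hc : ∀ i < p, c i < c p ∨ c i < c (p + 1)) :
    c p = a p ∧ c (p + 1) = a (p + 1) := by
  have hle : ∀ i < p + 2, c i ≤ a (p + 1) := by
    intro i hi
    obtain ⟨j, hj, hji⟩ := exists_eq_of_map_range_eq h hi
    exact hji ▸ ha j (by omega)
  have hnot : a (p + 1) ∉ (Multiset.range p).map c := by
    simp only [Multiset.mem_map, Multiset.mem_range, not_exists, not_and]
    intro i hi
    have h1 := hle p (by omega)
    have h2 := hle (p + 1) (by omega)
    rcases hc i hi with h | h <;> omega
  have hcount := congrArg (Multiset.count (a (p + 1))) h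
  simp only [Multiset.range_succ, Multiset.map_cons, Multiset.count_cons, hp,
    Multiset.count_eq_zero_of_notMem hnot, if_true] at hcount
  rw [hp]
  split_ifs at hcount <;> omega

theorem eq_of_paired_tail {a c : ℕ → ℕ} {u : ℕ} (q : ℕ)
    (h : (Multiset.range (u + 2 * q)).map c = (Multiset.range (u + 2 * q)).map a)
    (hpair : ∀ k < q, a (u + 2 * k) = a (u + 2 * k + 1))
    (ha : ∀ i j, i ≤ j → j < u + 2 * q → a i ≤ a j)
    (hc : ∀ p i, u ≤ p → p + 1 < u + 2 * q → i < p → c i < c p ∨ c i < c (p + 1)) :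
    ∀ i, u ≤ i → i < u + 2 * q → c i = a i := by
  induction q with
  | zero => intro i h1 h2; omega
  | succ q ih =>
    obtain ⟨h1, h2⟩ := eq_of_top_pair (p := u + 2 * q) h (hpair q (by omega))
      (fun i hi => ha i _ hi (by omega)) (fun i hi => hc _ i (by omega) (by omega) hi)
    have h' := Multiset.map_range_eq_of_eq_above (k := u + 2 * q) 2 h (by
      intro i hi1 hi2
      obtain rfl | rfl : i = u + 2 * q ∨ i = u + 2 * q + 1 := by omega
      exacts [h1, h2])
    intro i hi1 hi2
    by_cases hi : i < u + 2 * q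
    · exact ih h' (fun k hk => hpair k (by omega)) (fun i j hij hj => ha i j hij (by omega))
        (fun p i h1 h2 h3 => hc p i h1 (by omega) h3) i hi1 hi
    · obtain rfl | rfl : i = u + 2 * q ∨ i = u + 2 * q + 1 := by omega
      exacts [h1, h2]

theorem le_of_forall_le_succ {a : ℕ → ℕ} {N : ℕ} (h : ∀ i, i + 1 ≤ N → a i ≤ a (i + 1)) {i j : ℕ}
    (hij : i ≤ j) (hj : j ≤ N) : a i ≤ a j := by
  induction j, hij using Nat.le_induction with
  | base => exact le_rfl
  | succ j _ ih => exact (ih (by omega)).trans (h j hj)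

theorem lt_of_forall_lt_add_two {b : ℕ → ℕ} {N : ℕ} (h : ∀ i, i + 2 ≤ N → b i < b (i + 2))
    {i j : ℕ} (hij : i < j) (hpar : i % 2 = j % 2) (hj : j ≤ N) : b i < b j := by
  obtain ⟨k, rfl⟩ : ∃ k, j = i + 2 * (k + 1) := ⟨(j - i) / 2 - 1, by omega⟩
  clear hij hpar
  induction k with
  | zero => exact h i hj
  | succ k ih => exact (ih (by omega)).trans (h (i + 2 * (k + 1)) hj)

/-- A value that is not attained exactly once is attained at a neighbouring index. -/
theorem eq_neighbour_of_card_ne_one {a : ℕ → ℕ} {N i : ℕ}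
    (hmono : ∀ i, i + 1 ≤ N → a i ≤ a (i + 1)) (hstrict : ∀ i, i + 2 ≤ N → a i < a (i + 2))
    (hi : i ≤ N) (hcard : ((Finset.range (N + 1)).filter fun j => a j = a i).card ≠ 1) :
    (i + 1 ≤ N ∧ a (i + 1) = a i) ∨ (1 ≤ i ∧ a (i - 1) = a i) := by
  have : ∃ j ≤ N, j ≠ i ∧ a j = a i := by
    by_contra! hne
    refine hcard (Finset.card_eq_one.2 ⟨i, ?_⟩)
    ext j
    simp only [Finset.mem_filter, Finset.mem_range, Finset.mem_singleton]
    constructor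
    · rintro ⟨h1, h2⟩
      by_contra h3
      exact hne j (by omega) h3 h2
    · rintro rfl
      exact ⟨by omega, rfl⟩
  obtain ⟨j, hj, hne, heq⟩ := this
  rcases lt_or_gt_of_ne hne with h | h
  · right
    have hji : j = i - 1 := by
      by_contra h'
      have h1 := le_of_forall_le_succ hmono (i := j) (j := i - 2) (by omega) (by omega)
      have h2 := hstrict (i - 2) (by omega)
      rw [show i - 2 + 2 = i by omega] at h2
      omega
    exact ⟨by omega, hji ▸ heq⟩
  · left
    have hji : j = i + 1 := by
      by_contra h'
      have h1 := le_of_forall_le_succ hmono (i := i + 2) (j := j) (by omega) (by omega)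
      have h2 := hstrict i (by omega)
      omega
    exact ⟨by omega, hji ▸ heq⟩

theorem paired_of_card_ne_one {a : ℕ → ℕ} {N u w : ℕ}
    (hmono : ∀ i, i + 1 ≤ N → a i ≤ a (i + 1)) (hstrict : ∀ i, i + 2 ≤ N → a i < a (i + 2))
    (hw : w ≤ N + 1) (hu : u + 1 ≤ N → a u ≠ a (u + 1))
    (hcard : ∀ i, u < i → i < w → ((Finset.range (N + 1)).filter fun j => a j = a i).card ≠ 1)
    (k : ℕ) (hk : u + 2 * k + 1 < w) :
    u + 2 * k + 2 ≤ N ∧ a (u + 2 * k + 1) = a (u + 2 * k + 2) := by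
  induction k with
  | zero =>
    rcases eq_neighbour_of_card_ne_one hmono hstrict (by omega)
      (hcard (u + 1) (by omega) (by omega)) with h | h
    · exact ⟨h.1, h.2.symm⟩
    · exact absurd h.2 (hu (by omega))
  | succ k ih =>
    obtain ⟨-, h2⟩ := ih (by omega)
    rcases eq_neighbour_of_card_ne_one hmono hstrict (by omega)
      (hcard (u + 2 * (k + 1) + 1) (by omega) (by omega)) with h | h
    · exact ⟨h.1, h.2.symm⟩
    · have h3 := hstrict (u + 2 * k + 1) (by omega)
      have h4 : a (u + 2 * k + 2) = a (u + 2 * k + 1 + 2) := h.2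
      omega

theorem ne_of_card_eq_one {a : ℕ → ℕ} {N i j : ℕ} (hi : i ≤ N) (hj : j ≤ N) (hij : j ≠ i)
    (hcard : ((Finset.range (N + 1)).filter fun j => a j = a i).card = 1) : a j ≠ a i := by
  intro h
  exact hij (Finset.card_le_one.1 hcard.le j (by simp [h]; omega) i (by simp; omega))

/-- The involution exchanging `r + 2k` and `r + 2k + 1` inside `[r, t]`, for `r` odd and `t`
even. -/
def blockSwap (r t i : ℕ) : ℕ :=
  if r ≤ i ∧ i ≤ t then (if i % 2 = 1 then i + 1 else i - 1) else i

theorem blockSwap_of_mem {r t i : ℕ} (hi : r ≤ i) (hit : i ≤ t) :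
    (i % 2 = 1 ∧ blockSwap r t i = i + 1) ∨ (i % 2 = 0 ∧ blockSwap r t i = i - 1) := by
  rcases Nat.mod_two_eq_zero_or_one i with h | h <;> simp [blockSwap, hi, hit, h]

theorem blockSwap_of_lt {r t i : ℕ} (hi : i < r) : blockSwap r t i = i := by
  simp [blockSwap, Nat.not_le.2 hi]

theorem blockSwap_lt_of_lt {r t p i : ℕ} (hr : r % 2 = 1) (ht : t % 2 = 0) (hp : r + 1 ≤ p)
    (hpt : p + 1 < t) (hip : i < p) :
    (blockSwap r t i < blockSwap r t p ∧ blockSwap r t i % 2 = blockSwap r t p % 2) ∨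
    (blockSwap r t i < blockSwap r t (p + 1) ∧
      blockSwap r t i % 2 = blockSwap r t (p + 1) % 2) := by
  have h1 := blockSwap_of_mem (r := r) (t := t) (i := p) (by omega) (by omega)
  have h2 := blockSwap_of_mem (r := r) (t := t) (i := p + 1) (by omega) (by omega)
  by_cases hi : i < r
  · rw [blockSwap_of_lt hi]
    omega
  · have h3 := blockSwap_of_mem (r := r) (t := t) (i := i) (by omega) (by omega)
    omega

theorem eq_on_block_of_rearrangement {a c : ℕ → ℕ} {N r t m : ℕ} (hr : r % 2 = 1)
    (ht : t = r + 2 * m + 1) (htN : t ≤ N) (ha : ∀ i j, i ≤ j → j ≤ N → a i ≤ a j)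
    (hpair : ∀ k < m, a (r + 2 * k + 1) = a (r + 2 * k + 2))
    (hmult : (Multiset.range (N + 1)).map c = (Multiset.range (N + 1)).map a)
    (hhat : (Multiset.range (N + 1)).map (fun i => c i + (i + 1) / 2)
        = (Multiset.range (N + 1)).map (fun i => a i + (i + 1) / 2))
    (hc : ∀ p i, r + 1 ≤ p → p + 1 < t → i < p → c i < c p ∨ c i < c (p + 1))
    (htop : ∀ i, t ≤ i → i ≤ N → c i = a i) :
    ∀ i, r ≤ i → i ≤ t → c i = a i := by
  have hblock : ∀ i, r + 1 ≤ i → i ≤ N → c i = a i := by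
    intro i hi hiN
    by_cases hit : t ≤ i
    · exact htop i hit hiN
    · have h1 : N + 1 = (r + 1 + 2 * m) + (N + 1 - t) := by omega
      refine eq_of_paired_tail (u := r + 1) m
        (Multiset.map_range_eq_of_eq_above (N + 1 - t) (h1 ▸ hmult) fun i h1 h2 =>
          htop i (by omega) (by omega)) ?_ (fun i j hij hj => ha i j hij (by omega))
        (fun p i h1 h2 h3 => hc p i h1 (by omega) h3) i hi (by omega)
      intro k hk
      have := hpair k hk
      rwa [show r + 1 + 2 * k = r + 2 * k + 1 by omega]
  have hN : N + 1 = (r + 1) + (N - r) := by omega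
  have hmult' := Multiset.map_range_eq_of_eq_above (k := r + 1) (N - r) (hN ▸ hmult)
    fun i h1 h2 => hblock i h1 (by omega)
  have hhat' := Multiset.map_range_eq_of_eq_above (k := r + 1) (N - r) (hN ▸ hhat)
    fun i h1 h2 => by simp only [hblock i h1 (by omega)]
  obtain ⟨j, hj, hjr⟩ := exists_eq_of_map_range_eq hhat'.symm (i := r) (by omega)
  obtain ⟨l, hl, hlj⟩ := exists_eq_of_map_range_eq hmult' hj
  have hle := ha l r (by omega) (by omega)
  have hjr' : j = r := by
    omega
  subst hjr'
  intro i hi hit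
  by_cases hij : i = j
  · subst hij
    simpa using hjr
  · exact hblock i (by omega) (by omega)


/-- Setup §1: assume `M ≥ 1` and let `b ∈ ℰ` satisfy `[b̂] = [â]`
as multisets.  Then exactly one of the following holds on the block of indices
`[i_{2M-1}, i_{2M}]`: either `b_i = a_i` for all `i` in the block, or
`b_{i_{2M-1}+2k} = a_{i_{2M-1}+2k+1}` and `b_{i_{2M-1}+2k+1} = a_{i_{2M-1}+2k}`
for all `0 ≤ k ≤ m_{2M-1}`. -/
theorem stmt_4 (N M : ℕ) (a I m : ℕ → ℕ)
    (hN : Even N)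
    (hM : 1 ≤ M)
    (hmono : ∀ i, i + 1 ≤ N → a i ≤ a (i + 1))
    (hstrict : ∀ i, i + 2 ≤ N → a i < a (i + 2))
    (hImono : ∀ s t, s < t → t ≤ 2 * M → I s < I t)
    (hIJ : ∀ i, (i ≤ N ∧ ((Finset.range (N + 1)).filter fun j => a j = a i).card = 1)
        ↔ ∃ s, s ≤ 2 * M ∧ I s = i)
    (hm : ∀ s, s < 2 * M → I (s + 1) = I s + 2 * m s + 1)
    -- `b ∈ ℰ`:
    (b : ℕ → ℕ)
    (hbstrict : ∀ i, i + 2 ≤ N → b i < b (i + 2))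
    (hbmult : (Multiset.range (N + 1)).map b = (Multiset.range (N + 1)).map a)
    -- `[b̂] = [â]`:
    (hbhat : (Multiset.range (N + 1)).map (fun i => b i + (i + 1) / 2)
        = (Multiset.range (N + 1)).map (fun i => a i + (i + 1) / 2)) :
    Xor'
      (∀ i, I (2 * M - 1) ≤ i → i ≤ I (2 * M) → b i = a i)
      (∀ k ≤ m (2 * M - 1), b (I (2 * M - 1) + 2 * k) = a (I (2 * M - 1) + 2 * k + 1)
          ∧ b (I (2 * M - 1) + 2 * k + 1) = a (I (2 * M - 1) + 2 * k)) := by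
  obtain ⟨M, rfl⟩ : ∃ M', M = M' + 1 := ⟨M - 1, by omega⟩
  have htm := hm (2 * (M + 1) - 1) (by omega)
  rw [show 2 * (M + 1) - 1 + 1 = 2 * (M + 1) by omega] at htm
  obtain ⟨hrN, hr1⟩ := (hIJ (I (2 * (M + 1) - 1))).2 ⟨_, by omega, rfl⟩
  obtain ⟨htN, ht1⟩ := (hIJ (I (2 * (M + 1)))).2 ⟨_, le_rfl, rfl⟩
  have hcard : ∀ i, I (2 * (M + 1) - 1) < i → i ≤ N → i ≠ I (2 * (M + 1)) →
      ((Finset.range (N + 1)).filter fun j => a j = a i).card ≠ 1 := by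
    intro i hri hiN hit h
    obtain ⟨s, hs, rfl⟩ := (hIJ i).1 ⟨hiN, h⟩
    have hs' : s < 2 * (M + 1) - 1 := by
      by_contra hs'
      obtain rfl | rfl : s = 2 * (M + 1) - 1 ∨ s = 2 * (M + 1) := by omega
      · omega
      · exact hit rfl
    have := hImono s (2 * (M + 1) - 1) hs' (by omega)
    omega
  generalize I (2 * (M + 1) - 1) = r at *
  generalize I (2 * (M + 1)) = t at *
  generalize m (2 * (M + 1) - 1) = m at *
  have ha : ∀ i j, i ≤ j → j ≤ N → a i ≤ a j := fun i j => le_of_forall_le_succ hmono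
  have hb : ∀ i j, i < j → i % 2 = j % 2 → j ≤ N → b i < b j :=
    fun i j => lt_of_forall_lt_add_two hbstrict
  have hpairt := paired_of_card_ne_one hmono hstrict (u := t) (w := N + 1) le_rfl
    (fun h => (ne_of_card_eq_one htN h (by omega) ht1).symm)
    (fun i h1 h2 => hcard i (by omega) (by omega) (by omega))
  have hpairr := paired_of_card_ne_one hmono hstrict (u := r) (w := t) (by omega)
    (fun h => (ne_of_card_eq_one hrN h (by omega) hr1).symm)
    (fun i h1 h2 => hcard i (by omega) (by omega) (by omega))
  have hteven : t % 2 = 0 := by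
    by_contra h
    have hN2 := Nat.even_iff.1 hN
    have := (hpairt ((N - t - 1) / 2) (by omega)).1
    omega
  have hN2 := Nat.even_iff.1 hN
  have htop : ∀ i, t + 1 ≤ i → i ≤ N → b i = a i := by
    have h1 : N + 1 = t + 1 + 2 * ((N - t) / 2) := by omega
    intro i hi hiN
    refine eq_of_paired_tail (u := t + 1) ((N - t) / 2) (h1 ▸ hbmult) ?_
      (fun i j hij hj => ha i j hij (by omega)) ?_ i hi (by omega)
    · intro k hk
      have := (hpairt k (by omega)).2
      rwa [show t + 1 + 2 * k = t + 2 * k + 1 by omega]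
    · intro p i hp1 hp2 hip
      by_cases hpar : i % 2 = p % 2
      · exact Or.inl (hb i p hip hpar (by omega))
      · exact Or.inr (hb i (p + 1) (by omega) (by omega) (by omega))
  have hN1 : N + 1 = (t + 1) + (N - t) := by omega
  have hmult' := Multiset.map_range_eq_of_eq_above (k := t + 1) (N - t) (hN1 ▸ hbmult)
    fun i h1 h2 => htop i h1 (by omega)
  have hble : ∀ i ≤ t, b i ≤ a t := by
    intro i hi
    obtain ⟨j, hj, hji⟩ := exists_eq_of_map_range_eq hmult' (i := i) (by omega)
    exact hji ▸ ha j t (by omega) htN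
  have hmax : b t = a t ∨ b (t - 1) = a t := by
    obtain ⟨j, hj, hjt⟩ := exists_eq_of_map_range_eq hmult'.symm (i := t) (by omega)
    by_cases hj' : j + 2 ≤ t
    · have h1 := hbstrict j (by omega)
      have h2 := hble (j + 2) hj'
      omega
    · obtain rfl | rfl : j = t ∨ j = t - 1 := by omega
      exacts [Or.inl hjt, Or.inr hjt]
  have hexcl : ¬ ((∀ i, r ≤ i → i ≤ t → b i = a i) ∧ ∀ k ≤ m, b (r + 2 * k) = a (r + 2 * k + 1)
      ∧ b (r + 2 * k + 1) = a (r + 2 * k)) := by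
    rintro ⟨h1, h2⟩
    have h3 := (h2 m le_rfl).1
    rw [h1 (r + 2 * m) (by omega) (by omega), ← htm] at h3
    exact ne_of_card_eq_one htN (by omega) (by omega) ht1 h3
  have hor : (∀ i, r ≤ i → i ≤ t → b i = a i) ∨ ∀ k ≤ m, b (r + 2 * k) = a (r + 2 * k + 1)
      ∧ b (r + 2 * k + 1) = a (r + 2 * k) := by
    rcases hmax with h | h
    · left
      refine eq_on_block_of_rearrangement (by omega) htm htN ha
        (fun k hk => (hpairr k (by omega)).2) hbmult hbhat ?_ ?_
      · intro p i hp1 hp2 hip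
        by_cases hpar : i % 2 = p % 2
        · exact Or.inl (hb i p hip hpar (by omega))
        · exact Or.inr (hb i (p + 1) (by omega) (by omega) (by omega))
      · intro i hti hiN
        rcases hti.eq_or_lt with rfl | hti
        · exact h
        · exact htop i hti hiN
    · right
      have hinv : Function.Involutive (blockSwap r t) := by
        intro i
        unfold blockSwap
        split_ifs <;> omega
      have hlt : ∀ i < N + 1, blockSwap r t i < N + 1 := by
        intro i hi
        unfold blockSwap
        split_ifs <;> omega
      have hhalf : ∀ i, (i + 1) / 2 = (blockSwap r t i + 1) / 2 := by
        intro i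
        unfold blockSwap
        split_ifs <;> omega
      have hswap : ∀ i, r ≤ i → i ≤ t → b (blockSwap r t i) = a i := by
        refine eq_on_block_of_rearrangement (c := fun i => b (blockSwap r t i)) (by omega) htm htN
          ha (fun k hk => (hpairr k (by omega)).2)
          ((Multiset.map_range_comp_of_involutive hinv hlt b).trans hbmult) ?_ ?_ ?_
        · rw [← hbhat, ← Multiset.map_range_comp_of_involutive hinv hlt
            (fun i => b i + (i + 1) / 2)]
          simp only [← hhalf]
        · intro p i hp1 hp2 hip
          exact (blockSwap_lt_of_lt (by omega) hteven hp1 hp2 hip).imp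
            (fun h => hb _ _ h.1 h.2 (Nat.lt_succ_iff.1 (hlt _ (by omega))))
            (fun h => hb _ _ h.1 h.2 (Nat.lt_succ_iff.1 (hlt _ (by omega))))
        · intro i hti hiN
          rcases hti.eq_or_lt with rfl | hti
          · have : blockSwap r t t = t - 1 := by
              unfold blockSwap
              split_ifs <;> omega
            simpa only [this] using h
          · have : blockSwap r t i = i := by
              unfold blockSwap
              split_ifs <;> omega
            simpa only [this] using htop i hti hiN
      intro k hk
      have h1 : blockSwap r t (r + 2 * k + 1) = r + 2 * k := by
        unfold blockSwap
        split_ifs <;> omega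
      have h2 : blockSwap r t (r + 2 * k) = r + 2 * k + 1 := by
        unfold blockSwap
        split_ifs <;> omega
      have h3 := hswap (r + 2 * k + 1) (by omega) (by omega)
      have h4 := hswap (r + 2 * k) (by omega) (by omega)
      rw [h1] at h3
      rw [h2] at h4
      exact ⟨h3, h4⟩
  rcases hor with h | h
  · exact Or.inl ⟨h, fun h' => hexcl ⟨h, h'⟩⟩
  · exact Or.inr ⟨h, fun h' => hexcl ⟨h', h⟩⟩
end

section
/- In Setup (§1): the map X ↦ a^X from subsets X ⊆ {1,3,…,2M−1} to ℕ^{N+1} is injective, and {b ∈ ℰ : [b̂] = [â]} = {a^X : X ⊆ {1,3,…,2M−1}}; consequently the set {b ∈ ℰ : [b̂] = [â]} has exactly 2^M elements. -/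
theorem Fin.univ_val_map_natCast {α : Type*} (n : ℕ) (f : ℕ → α) :
    (Finset.univ : Finset (Fin n)).val.map (fun i : Fin n => f i) = (Multiset.range n).map f := by
  rw [Fin.univ_val_map, ← Multiset.coe_range, Multiset.map_coe, List.ofFn_eq_map,
    ← List.map_coe_finRange_eq_range, List.map_map]
  rfl

/-- Two monotone tuples with the same multiset of entries are equal. -/
theorem Fin.eq_of_monotone_of_map_eq {n : ℕ} {f g : Fin n → ℕ} (hf : Monotone f) (hg : Monotone g)
    (h : Finset.univ.val.map f = Finset.univ.val.map g) : f = g := by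
  rw [Fin.univ_val_map, Fin.univ_val_map, Multiset.coe_eq_coe] at h
  exact List.ofFn_injective
    (h.eq_of_pairwise' hf.sortedLE_ofFn.pairwise hg.sortedLE_ofFn.pairwise)

/-- If the tuples `b` and `a` have the same entries, `a` and `c` are monotone, and the tuples
`b + c` and `a + c` have the same entries, then `b` varies together with `c`. -/
theorem Fin.monovary_of_map_add_eq {n : ℕ} {a b c : Fin n → ℕ} (ha : Monotone a) (hc : Monotone c)
    (h : Finset.univ.val.map b = Finset.univ.val.map a)
    (h' : Finset.univ.val.map (fun i => b i + c i) = Finset.univ.val.map (fun i => a i + c i)) :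
    Monovary b c := by
  have hsort : b ∘ Tuple.sort b = a := by
    refine Fin.eq_of_monotone_of_map_eq (Tuple.monotone_sort b) ha ?_
    rw [← h, Fin.univ_val_map, Fin.univ_val_map, Multiset.coe_eq_coe]
    exact (Tuple.sort b).ofFn_comp_perm b
  have hba : b = a ∘ (Tuple.sort b).symm := by
    rw [← hsort]; ext i; simp
  have hsq : ∑ i, b i ^ 2 = ∑ i, a i ^ 2 := by
    have := congrArg (fun s => (s.map (· ^ 2)).sum) h
    simpa only [Multiset.map_map, Function.comp_def, Finset.sum] using this
  have hsq' : ∑ i, (b i + c i) ^ 2 = ∑ i, (a i + c i) ^ 2 := by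
    have := congrArg (fun s => (s.map (· ^ 2)).sum) h'
    simpa only [Multiset.map_map, Function.comp_def, Finset.sum] using this
  have hmul : ∑ i, b i * c i = ∑ i, a i * c i := by
    simp only [add_sq, Finset.sum_add_distrib, mul_assoc, ← Finset.mul_sum] at hsq'
    omega
  have hac : Monovary a c := ha.monovary hc
  have key := hac.sum_comp_perm_mul_eq_sum_mul_iff (σ := (Tuple.sort b).symm)
  rw [hba] at hmul ⊢
  exact key.1 hmul

/-- Exchange the two members of the block `{2j - 1, 2j}` of indices for each `j ≥ 1` with `P j`. -/
def flipBlocks (P : ℕ → Prop) [DecidablePred P] (i : ℕ) : ℕ :=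
  if P ((i + 1) / 2) ∧ i ≠ 0 then (if i % 2 = 1 then i + 1 else i - 1) else i

section flipBlocks
variable (P : ℕ → Prop) [DecidablePred P]

theorem flipBlocks_block (i : ℕ) : (flipBlocks P i + 1) / 2 = (i + 1) / 2 := by
  unfold flipBlocks; split_ifs <;> omega

theorem flipBlocks_of_not {i : ℕ} (h : ¬ P ((i + 1) / 2)) : flipBlocks P i = i := by
  simp [flipBlocks, h]

theorem flipBlocks_of_odd {p : ℕ} (hp : p % 2 = 1) (h : P ((p + 1) / 2)) :
    flipBlocks P p = p + 1 := by
  have : p ≠ 0 := by omega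
  simp [flipBlocks, h, hp, this]

theorem flipBlocks_succ_of_odd {p : ℕ} (hp : p % 2 = 1) (h : P ((p + 1) / 2)) :
    flipBlocks P (p + 1) = p := by
  have e1 : (p + 1 + 1) / 2 = (p + 1) / 2 := by omega
  have e2 : (p + 1) % 2 ≠ 1 := by omega
  simp only [flipBlocks, e1, e2, h]
  simp

theorem flipBlocks_flipBlocks (i : ℕ) : flipBlocks P (flipBlocks P i) = i := by
  rw [flipBlocks, flipBlocks_block]
  unfold flipBlocks
  by_cases hP : P ((i + 1) / 2) ∧ i ≠ 0
  · obtain ⟨hP, hi⟩ := hP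
    rcases Nat.mod_two_eq_zero_or_one i with h2 | h2
    · have h3 : (i - 1) % 2 = 1 := by omega
      have h4 : i - 1 ≠ 0 := by omega
      simp only [hP, hi, h2, h3, h4, true_and, ne_eq, not_false_eq_true, if_true, zero_ne_one,
        if_false]
      omega
    · have h3 : (i + 1) % 2 = 0 := by omega
      simp [hP, hi, h2, h3]
  · simp only [hP, if_false]

theorem flipBlocks_le {N i : ℕ} (hN : Even N) (hi : i ≤ N) : flipBlocks P i ≤ N := by
  obtain ⟨r, rfl⟩ := hN
  unfold flipBlocks; split_ifs <;> omega

theorem map_flipBlocks_range {N : ℕ} (hN : Even N) :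
    (Multiset.range (N + 1)).map (flipBlocks P) = Multiset.range (N + 1) := by
  have hinj : Function.Injective (flipBlocks P) :=
    Function.Involutive.injective (flipBlocks_flipBlocks P)
  refine (((Multiset.nodup_range _).map hinj).ext (Multiset.nodup_range _)).2 fun i => ?_
  simp only [Multiset.mem_map, Multiset.mem_range, Nat.lt_succ_iff]
  constructor
  · rintro ⟨j, hj, rfl⟩
    exact flipBlocks_le P hN hj
  · exact fun hi => ⟨_, flipBlocks_le P hN hi, flipBlocks_flipBlocks P i⟩

theorem map_comp_flipBlocks {α : Type*} {N : ℕ} (hN : Even N) (f : ℕ → α) :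
    (Multiset.range (N + 1)).map (fun i => f (flipBlocks P i)) = (Multiset.range (N + 1)).map f := by
  conv_rhs => rw [← map_flipBlocks_range P hN, Multiset.map_map]
  rfl

end flipBlocks

/-- Within each block `{2j - 1, 2j}`, the sequence `b` agrees with `a` up to order. -/
theorem eq_or_swap_of_map_eq {N : ℕ} (hN : Even N) {a b : ℕ → ℕ}
    (hmono : ∀ i j, i ≤ j → j ≤ N → a i ≤ a j)
    (h : (Multiset.range (N + 1)).map b = (Multiset.range (N + 1)).map a)
    (h' : (Multiset.range (N + 1)).map (fun i => b i + (i + 1) / 2)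
      = (Multiset.range (N + 1)).map (fun i => a i + (i + 1) / 2)) :
    b 0 = a 0 ∧ ∀ p, p % 2 = 1 → p + 1 ≤ N →
      (b p = a p ∧ b (p + 1) = a (p + 1)) ∨ (b p = a (p + 1) ∧ b (p + 1) = a p) := by
  have ha : Monotone fun i : Fin (N + 1) => a i := fun i j hij => hmono i j hij (by omega)
  have hc : Monotone fun i : Fin (N + 1) => ((i : ℕ) + 1) / 2 := fun i j hij => by
    have : (i : ℕ) ≤ j := hij
    dsimp only; omega
  have hvary : Monovary (fun i : Fin (N + 1) => b i) fun i : Fin (N + 1) => ((i : ℕ) + 1) / 2 := by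
    refine Fin.monovary_of_map_add_eq ha hc ?_ ?_
    · rw [Fin.univ_val_map_natCast, Fin.univ_val_map_natCast, h]
    · rw [Fin.univ_val_map_natCast _ fun i => b i + (i + 1) / 2,
        Fin.univ_val_map_natCast _ fun i => a i + (i + 1) / 2, h']
  have hb : ∀ i j, i ≤ N → j ≤ N → (i + 1) / 2 < (j + 1) / 2 → b i ≤ b j := fun i j hi hj hij =>
    hvary (i := ⟨i, by omega⟩) (j := ⟨j, by omega⟩) hij
  classical
  let P : ℕ → Prop := fun j => b (2 * j) < b (2 * j - 1)
  have hfmono : Monotone fun i : Fin (N + 1) => b (flipBlocks P i) := by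
    intro i j hij
    have hij' : (i : ℕ) ≤ j := hij
    have hi := flipBlocks_le P hN (Nat.lt_succ_iff.1 i.2)
    have hj := flipBlocks_le P hN (Nat.lt_succ_iff.1 j.2)
    rcases lt_or_ge (((i : ℕ) + 1) / 2) ((j + 1) / 2) with hlt | hge
    · refine hb _ _ hi hj ?_
      rwa [flipBlocks_block, flipBlocks_block]
    · rcases hij'.eq_or_lt with he | hlt
      · simp [he]
      · have hP1 : (i : ℕ) % 2 = 1 := by omega
        have hP2 : (j : ℕ) = i + 1 := by omega
        have e : 2 * (((i : ℕ) + 1) / 2) = i + 1 := by omega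
        dsimp only
        rw [hP2]
        by_cases hP : P (((i : ℕ) + 1) / 2)
        · rw [flipBlocks_of_odd P hP1 hP, flipBlocks_succ_of_odd P hP1 hP]
          simp only [P, e, Nat.add_sub_cancel] at hP
          exact hP.le
        · rw [flipBlocks_of_not P hP, flipBlocks_of_not P
            (by rwa [show ((i : ℕ) + 1 + 1) / 2 = (i + 1) / 2 by omega])]
          simp only [P, e, Nat.add_sub_cancel, not_lt] at hP
          exact hP
  have heq := Fin.eq_of_monotone_of_map_eq hfmono ha (by
    rw [Fin.univ_val_map_natCast _ fun i => b (flipBlocks P i), Fin.univ_val_map_natCast,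
      map_comp_flipBlocks P hN, h])
  have heq' : ∀ i ≤ N, b (flipBlocks P i) = a i := fun i hi =>
    congrFun heq ⟨i, by omega⟩
  refine ⟨by simpa [flipBlocks] using heq' 0 (by omega), fun p hp hpN => ?_⟩
  have h1 := heq' p (by omega)
  have h2 := heq' (p + 1) hpN
  by_cases hP : P ((p + 1) / 2)
  · rw [flipBlocks_of_odd P hp hP] at h1
    rw [flipBlocks_succ_of_odd P hp hP] at h2
    exact Or.inr ⟨h2, h1⟩
  · rw [flipBlocks_of_not P hP] at h1
    rw [flipBlocks_of_not P (by rwa [show (p + 1 + 1) / 2 = (p + 1) / 2 by omega])] at h2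
    exact Or.inl ⟨h1, h2⟩

/-- A sequence `a_0 ≤ … ≤ a_N`, strictly increasing at distance two, whose entries of multiplicity
one sit at the indices `I 0 < … < I (2 * M)`, with `I (s + 1) = I s + 2 * m s + 1`. -/
structure IsSpecialSeq (N M : ℕ) (a I m : ℕ → ℕ) : Prop where
  mono : ∀ i j, i ≤ j → j ≤ N → a i ≤ a j
  strict : ∀ i j, i + 2 ≤ j → j ≤ N → a i < a j
  mono_I : ∀ s t, s < t → t ≤ 2 * M → I s < I t
  I_le : ∀ s ≤ 2 * M, I s ≤ N
  single : ∀ s ≤ 2 * M, ∀ j ≤ N, a j = a (I s) → j = I s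
  double : ∀ i ≤ N, (∀ s ≤ 2 * M, I s ≠ i) → ∃ j ≤ N, j ≠ i ∧ a j = a i
  I_succ : ∀ s < 2 * M, I (s + 1) = I s + 2 * m s + 1

theorem isSpecialSeq {N M : ℕ} {a I m : ℕ → ℕ}
    (hmono : ∀ i, i + 1 ≤ N → a i ≤ a (i + 1))
    (hstrict : ∀ i, i + 2 ≤ N → a i < a (i + 2))
    (hImono : ∀ s t, s < t → t ≤ 2 * M → I s < I t)
    (hIJ : ∀ i, (i ≤ N ∧ ((Finset.range (N + 1)).filter fun j => a j = a i).card = 1)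
        ↔ ∃ s, s ≤ 2 * M ∧ I s = i)
    (hm : ∀ s, s < 2 * M → I (s + 1) = I s + 2 * m s + 1) :
    IsSpecialSeq N M a I m := by
  have mono : ∀ i j, i ≤ j → j ≤ N → a i ≤ a j := by
    intro i j hij
    induction j, hij using Nat.le_induction with
    | base => simp
    | succ j hij ih => exact fun h => (ih (by omega)).trans (hmono j h)
  refine ⟨mono, fun i j hij hj => (hstrict i (by omega)).trans_le (mono _ _ hij hj), hImono,
    fun s hs => ((hIJ _).2 ⟨s, hs, rfl⟩).1, fun s hs j hj haj => ?_, fun i hi hI => ?_, hm⟩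
  · obtain ⟨hle, hcard⟩ := (hIJ _).2 ⟨s, hs, rfl⟩
    exact Finset.card_le_one.1 hcard.le j (by simp [haj]; omega) _ (by simp; omega)
  · by_contra! hne
    obtain ⟨s, hs, hsi⟩ := (hIJ i).1 ⟨hi, Finset.card_eq_one.2 ⟨i, by
      ext j
      simp only [Finset.mem_filter, Finset.mem_range, Finset.mem_singleton]
      refine ⟨fun ⟨hj, haj⟩ => ?_, fun hj => ⟨by omega, by rw [hj]⟩⟩
      by_contra hji
      exact hne j (by omega) hji haj⟩⟩
    exact hI s hs hsi

namespace IsSpecialSeq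

variable {N M : ℕ} {a I m : ℕ → ℕ}

/-- A run `u, …, v - 1` of indices of repeated entries which starts with a new entry splits into
consecutive pairs of equal entries. -/
theorem eq_succ_of_run (h : IsSpecialSeq N M a I m) {u v : ℕ} (hv : v ≤ N + 1)
    (hu : ∀ i, i + 1 = u → i ≤ N → u ≤ N → a i ≠ a u)
    (hrun : ∀ i, u ≤ i → i < v → ∀ s ≤ 2 * M, I s ≠ i) (l : ℕ) (hl : u + 2 * l < v) :
    u + 2 * l + 1 ≤ N ∧ a (u + 2 * l) = a (u + 2 * l + 1) := by
  induction l with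
  | zero =>
    obtain ⟨j, hj, hne, haj⟩ := h.double u (by omega) (hrun u le_rfl (by omega))
    have h1 := h.strict j u
    have h2 := h.strict u j
    have h3 := hu j
    obtain rfl : j = u + 1 := by omega
    exact ⟨hj, haj.symm⟩
  | succ l ih =>
    obtain ⟨-, ih⟩ := ih (by omega)
    obtain ⟨j, hj, hne, haj⟩ := h.double (u + 2 * (l + 1)) (by omega)
      (hrun _ (by omega) (by omega))
    have h1 := h.strict j (u + 2 * (l + 1))
    have h2 := h.strict (u + 2 * (l + 1)) j
    have h3 := h.strict (u + 2 * l) (u + 2 * (l + 1)) (by omega) (by omega)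
    rw [ih] at h3
    by_cases hj' : j = u + 2 * l + 1
    · subst hj'; omega
    · obtain rfl : j = u + 2 * (l + 1) + 1 := by omega
      exact ⟨hj, haj.symm⟩

theorem mono_I_le (h : IsSpecialSeq N M a I m) {s t : ℕ} (hs : s ≤ t) (ht : t ≤ 2 * M) :
    I s ≤ I t := by
  rcases hs.eq_or_lt with rfl | hs
  · rfl
  · exact (h.mono_I s t hs ht).le

theorem lt_succ_I (h : IsSpecialSeq N M a I m) {s : ℕ} (hs : s ≤ 2 * M) (hN : I s + 1 ≤ N) :
    a (I s) < a (I s + 1) :=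
  lt_of_le_of_ne (h.mono _ _ (by omega) hN) fun he => by
    have := h.single s hs _ hN he.symm
    omega

theorem lt_I (h : IsSpecialSeq N M a I m) {s i : ℕ} (hs : s ≤ 2 * M) (hi : i + 1 = I s) :
    a i < a (I s) :=
  have hN := h.I_le s hs
  lt_of_le_of_ne (h.mono _ _ (by omega) hN) fun he => by
    have := h.single s hs _ (by omega) he
    omega

theorem eq_succ_of_lt_I_zero (h : IsSpecialSeq N M a I m) {l : ℕ} (hl : 2 * l < I 0) :
    a (2 * l) = a (2 * l + 1) := by
  have h0 := h.I_le 0 (by omega)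
  have := (h.eq_succ_of_run (u := 0) (v := I 0) (by omega) (by omega)
    (fun i _ hi s hs => by have := h.mono_I_le (Nat.zero_le s) hs; omega) l (by omega)).2
  simpa using this

theorem I_zero_even (h : IsSpecialSeq N M a I m) : I 0 % 2 = 0 := by
  by_contra hodd
  have h1 := h.eq_succ_of_lt_I_zero (l := I 0 / 2) (by omega)
  have h2 := h.lt_I (s := 0) (i := 2 * (I 0 / 2)) (by omega) (by omega)
  rw [h1, show 2 * (I 0 / 2) + 1 = I 0 by omega] at h2
  exact h2.false

theorem I_mod_two (h : IsSpecialSeq N M a I m) {s : ℕ} (hs : s ≤ 2 * M) : I s % 2 = s % 2 := by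
  induction s with
  | zero => exact h.I_zero_even
  | succ s ih =>
    have := ih (by omega)
    have := h.I_succ s (by omega)
    omega

theorem eq_succ_of_between (h : IsSpecialSeq N M a I m) {s l : ℕ} (hs : s < 2 * M) (hl : l < m s) :
    a (I s + 1 + 2 * l) = a (I s + 1 + 2 * l + 1) := by
  have hN := h.I_le (s + 1) (by omega)
  have hsucc := h.I_succ s hs
  refine (h.eq_succ_of_run (u := I s + 1) (v := I (s + 1)) (by omega) ?_ ?_ l (by omega)).2
  · intro i hi _ hu
    obtain rfl : i = I s := by omega
    exact (h.lt_succ_I hs.le hu).ne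
  · intro i hi hi' t ht
    rcases le_or_gt t s with hts | hts
    · have := h.mono_I_le hts hs.le
      omega
    · have := h.mono_I_le hts ht
      simp only [Nat.succ_eq_add_one] at this
      omega

theorem eq_succ_of_I_last_lt (h : IsSpecialSeq N M a I m) {l : ℕ} (hl : I (2 * M) + 1 + 2 * l ≤ N) :
    a (I (2 * M) + 1 + 2 * l) = a (I (2 * M) + 1 + 2 * l + 1) := by
  refine (h.eq_succ_of_run (u := I (2 * M) + 1) (v := N + 1) le_rfl ?_ ?_ l (by omega)).2
  · intro i hi _ hu
    obtain rfl : i = I (2 * M) := by omega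
    exact (h.lt_succ_I le_rfl hu).ne
  · intro i hi hi' t ht
    have := h.mono_I_le ht le_rfl
    omega

/-- Each block `{p, p + 1}` with `p` odd consists of equal entries, or lies before the first simple
entry, or lies between the simple entries number `s` and `s + 1` for some odd `s`. -/
theorem block_cases (h : IsSpecialSeq N M a I m) {p : ℕ} (hp : p % 2 = 1) (hN : p + 1 ≤ N) :
    a p = a (p + 1) ∨ p < I 0 ∨
      ∃ s < 2 * M, s % 2 = 1 ∧ ∃ k ≤ m s, p = I s + 2 * k := by
  by_cases h0 : p < I 0
  · exact Or.inr (Or.inl h0)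
  have hg : I (Nat.findGreatest (fun s => I s ≤ p) (2 * M)) ≤ p :=
    Nat.findGreatest_spec (P := fun s => I s ≤ p) (Nat.zero_le _) (by omega)
  have hg' : ∀ t, Nat.findGreatest (fun s => I s ≤ p) (2 * M) < t → t ≤ 2 * M → ¬ I t ≤ p :=
    fun t => Nat.findGreatest_is_greatest (P := fun s => I s ≤ p)
  have hle := Nat.findGreatest_le (P := fun s => I s ≤ p) (2 * M)
  generalize Nat.findGreatest (fun s => I s ≤ p) (2 * M) = s at *
  have hpar := h.I_mod_two hle
  rcases hle.eq_or_lt with rfl | hlt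
  · obtain ⟨l, rfl⟩ : ∃ l, p = I (2 * M) + 1 + 2 * l := ⟨(p - (I (2 * M) + 1)) / 2, by omega⟩
    exact Or.inl (h.eq_succ_of_I_last_lt (by omega))
  · have hsucc := h.I_succ s hlt
    have hps := hg' (s + 1) (by omega) (by omega)
    by_cases hs : s % 2 = 1
    · exact Or.inr (Or.inr ⟨s, hlt, hs, (p - I s) / 2, by omega, by omega⟩)
    · obtain ⟨l, rfl⟩ : ∃ l, p = I s + 1 + 2 * l := ⟨(p - (I s + 1)) / 2, by omega⟩
      exact Or.inl (h.eq_succ_of_between hlt (by omega))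

/-- The index intervals `[I s, I (s + 1)]` with `s` odd are pairwise disjoint. -/
theorem eq_of_mem_intervals (h : IsSpecialSeq N M a I m) {s t i : ℕ} (hs : s < 2 * M)
    (hs' : s % 2 = 1) (ht : t < 2 * M) (ht' : t % 2 = 1) (his : I s ≤ i ∧ i ≤ I s + 2 * m s + 1)
    (hit : I t ≤ i ∧ i ≤ I t + 2 * m t + 1) : s = t := by
  have h1 := h.I_succ s hs
  have h2 := h.I_succ t ht
  rcases lt_trichotomy s t with hst | hst | hst
  · have := h.mono_I (s + 1) t (by omega) (by omega)
    omega
  · exact hst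
  · have := h.mono_I (t + 1) s (by omega) (by omega)
    omega

/-- A sequence increasing at distance two which agrees with `a` up to order on each block either
agrees with `a`, or is exchanged with respect to `a`, uniformly on each odd interval. -/
theorem uniform_on_interval (h : IsSpecialSeq N M a I m) {b : ℕ → ℕ}
    (hb : ∀ i, i + 2 ≤ N → b i < b (i + 2))
    (hblock : ∀ p, p % 2 = 1 → p + 1 ≤ N →
      (b p = a p ∧ b (p + 1) = a (p + 1)) ∨ (b p = a (p + 1) ∧ b (p + 1) = a p))
    {s k : ℕ} (hs : s < 2 * M) (hs' : s % 2 = 1) (hk : k ≤ m s) :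
    (b (I s) = a (I s) → b (I s + 2 * k) = a (I s + 2 * k) ∧
      b (I s + 2 * k + 1) = a (I s + 2 * k + 1)) ∧
    (b (I s) ≠ a (I s) → b (I s + 2 * k) = a (I s + 2 * k + 1) ∧
      b (I s + 2 * k + 1) = a (I s + 2 * k)) := by
  have hpar := h.I_mod_two hs.le
  have hsucc := h.I_succ s hs
  have hN := h.I_le (s + 1) (by omega)
  induction k with
  | zero =>
    have hlt := h.lt_succ_I hs.le (by omega)
    simp only [Nat.mul_zero, Nat.add_zero]
    rcases hblock (I s) (by omega) (by omega) with hc | hc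
    · exact ⟨fun _ => hc, fun hne => absurd hc.1 hne⟩
    · exact ⟨fun he => by omega, fun _ => hc⟩
  | succ k ih =>
    obtain ⟨ih1, ih2⟩ := ih (by omega)
    have heq := h.eq_succ_of_between hs (l := k) (by omega)
    have hb1 := hb (I s + 2 * k) (by omega)
    have hb2 := hb (I s + 2 * k + 1) (by omega)
    have hc := hblock (I s + 2 * k + 2) (by omega) (by omega)
    rw [show I s + 1 + 2 * k = I s + 2 * k + 1 by ring] at heq
    rw [show I s + 2 * k + 1 + 2 = I s + 2 * k + 2 + 1 by ring] at hb2
    rw [show I s + 2 * k + 1 + 1 = I s + 2 * k + 2 by ring] at heq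
    rw [show I s + 2 * (k + 1) = I s + 2 * k + 2 by ring]
    refine ⟨fun he => ?_, fun hne => ?_⟩
    · have := ih1 he
      exact hc.resolve_right (by omega)
    · have := ih2 hne
      exact hc.resolve_left (by omega)

theorem eq_before_I_zero (h : IsSpecialSeq N M a I m) {b : ℕ → ℕ}
    (hb : ∀ i, i + 2 ≤ N → b i < b (i + 2)) (hb0 : b 0 = a 0)
    (hblock : ∀ p, p % 2 = 1 → p + 1 ≤ N →
      (b p = a p ∧ b (p + 1) = a (p + 1)) ∨ (b p = a (p + 1) ∧ b (p + 1) = a p))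
    {l : ℕ} (hl : 2 * l < I 0) :
    b (2 * l) = a (2 * l) ∧ b (2 * l + 1) = a (2 * l + 1) ∧
      b (2 * l + 1 + 1) = a (2 * l + 1 + 1) := by
  have hN := h.I_le 0 (by omega)
  have hpar := h.I_zero_even
  have key : b (2 * l) = a (2 * l) := by
    induction l with
    | zero => simpa using hb0
    | succ l ih =>
      have heq := h.eq_succ_of_lt_I_zero (l := l) (by omega)
      have hb1 := hb (2 * l) (by omega)
      have := ih (by omega)
      rcases hblock (2 * l + 1) (by omega) (by omega) with hc | hc
      · exact hc.2
      · rw [show 2 * l + 2 = 2 * l + 1 + 1 by ring] at hb1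
        omega
  have heq := h.eq_succ_of_lt_I_zero hl
  have hb1 := hb (2 * l) (by omega)
  rw [show 2 * l + 2 = 2 * l + 1 + 1 by ring] at hb1
  exact ⟨key, (hblock (2 * l + 1) (by omega) (by omega)).resolve_right (by omega)⟩

variable {S : Finset ℕ} {aX : Finset ℕ → ℕ → ℕ}

theorem exchange_injective (h : IsSpecialSeq N M a I m)
    (hS : ∀ s, s ∈ S ↔ s < 2 * M ∧ s % 2 = 1)
    (haX : ∀ X ⊆ S, ∀ s ∈ X, ∀ k ≤ m s,
        aX X (I s + 2 * k) = a (I s + 2 * k + 1)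
        ∧ aX X (I s + 2 * k + 1) = a (I s + 2 * k))
    (haX' : ∀ X ⊆ S, ∀ i ≤ N,
        (∀ s ∈ X, ¬ (I s ≤ i ∧ i ≤ I s + 2 * m s + 1)) → aX X i = a i) :
    ∀ X ⊆ S, ∀ Y ⊆ S, (∀ i ≤ N, aX X i = aX Y i) → X = Y := by
  suffices key : ∀ X ⊆ S, ∀ Y ⊆ S, (∀ i ≤ N, aX X i = aX Y i) → X ⊆ Y from
    fun X hX Y hY hXY =>
      (key X hX Y hY hXY).antisymm (key Y hY X hX fun i hi => (hXY i hi).symm)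
  intro X hX Y hY hXY s hs
  by_contra hsY
  obtain ⟨hs1, hs2⟩ := (hS s).1 (hX hs)
  have hN := h.I_le (s + 1) (by omega)
  have hsucc := h.I_succ s hs1
  have h1 := (haX X hX s hs 0 (Nat.zero_le _)).1
  have h2 := haX' Y hY (I s) (by omega) fun t ht hmem => by
    obtain ⟨ht1, ht2⟩ := (hS t).1 (hY ht)
    exact hsY (h.eq_of_mem_intervals hs1 hs2 ht1 ht2 ⟨le_rfl, by omega⟩ hmem ▸ ht)
  have h3 := hXY (I s) (by omega)
  have h4 := h.lt_succ_I hs1.le (by omega)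
  simp only [Nat.mul_zero, Nat.add_zero] at h1
  omega

open Classical in
/-- The exchanged sequence is `a` precomposed with a flip of blocks. -/
theorem exchange_eq_flipBlocks (h : IsSpecialSeq N M a I m)
    (hS : ∀ s, s ∈ S ↔ s < 2 * M ∧ s % 2 = 1)
    (haX : ∀ X ⊆ S, ∀ s ∈ X, ∀ k ≤ m s,
        aX X (I s + 2 * k) = a (I s + 2 * k + 1)
        ∧ aX X (I s + 2 * k + 1) = a (I s + 2 * k))
    (haX' : ∀ X ⊆ S, ∀ i ≤ N,
        (∀ s ∈ X, ¬ (I s ≤ i ∧ i ≤ I s + 2 * m s + 1)) → aX X i = a i)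
    {X : Finset ℕ} (hX : X ⊆ S) {i : ℕ} (hi : i ≤ N) :
    aX X i = a (flipBlocks (fun j => ∃ s ∈ X, I s < 2 * j ∧ 2 * j ≤ I s + 2 * m s + 1) i) := by
  by_cases hex : ∃ s ∈ X, I s ≤ i ∧ i ≤ I s + 2 * m s + 1
  · obtain ⟨s, hs, hsi⟩ := hex
    obtain ⟨hs1, hs2⟩ := (hS s).1 (hX hs)
    have hpar := h.I_mod_two hs1.le
    obtain ⟨k, hk, hik⟩ : ∃ k ≤ m s, i = I s + 2 * k ∨ i = I s + 2 * k + 1 :=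
      ⟨(i - I s) / 2, by omega, by omega⟩
    have hP : ∃ t ∈ X, I t < 2 * ((I s + 2 * k + 1) / 2) ∧
        2 * ((I s + 2 * k + 1) / 2) ≤ I t + 2 * m t + 1 := ⟨s, hs, by omega, by omega⟩
    rcases hik with rfl | rfl
    · rw [flipBlocks_of_odd _ (by omega) hP]
      exact (haX X hX s hs k hk).1
    · rw [flipBlocks_succ_of_odd _ (by omega) hP]
      exact (haX X hX s hs k hk).2
  · push Not at hex
    rw [haX' X hX i hi fun s hs hsi => by have := hex s hs hsi.1; omega, flipBlocks_of_not]
    rintro ⟨s, hs, hs1, hs2⟩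
    have hpar := h.I_mod_two ((hS s).1 (hX hs)).1.le
    have := ((hS s).1 (hX hs)).2
    have := hex s hs (by omega)
    omega

theorem exchange_strict (h : IsSpecialSeq N M a I m)
    (hS : ∀ s, s ∈ S ↔ s < 2 * M ∧ s % 2 = 1)
    (haX : ∀ X ⊆ S, ∀ s ∈ X, ∀ k ≤ m s,
        aX X (I s + 2 * k) = a (I s + 2 * k + 1)
        ∧ aX X (I s + 2 * k + 1) = a (I s + 2 * k))
    (haX' : ∀ X ⊆ S, ∀ i ≤ N,
        (∀ s ∈ X, ¬ (I s ≤ i ∧ i ≤ I s + 2 * m s + 1)) → aX X i = a i)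
    {X : Finset ℕ} (hX : X ⊆ S) {i : ℕ} (hi : i + 2 ≤ N) : aX X i < aX X (i + 2) := by
  by_cases h1 : ∃ s ∈ X, I s ≤ i ∧ i ≤ I s + 2 * m s + 1
  · obtain ⟨s, hs, hsi⟩ := h1
    obtain ⟨hs1, hs2⟩ := (hS s).1 (hX hs)
    have hsucc := h.I_succ s hs1
    have hIN := h.I_le (s + 1) (by omega)
    obtain ⟨k, hk, hik⟩ : ∃ k ≤ m s, i = I s + 2 * k ∨ i = I s + 2 * k + 1 :=
      ⟨(i - I s) / 2, by omega, by omega⟩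
    have hk1 := haX X hX s hs k hk
    by_cases hkm : k < m s
    · have hk2 := haX X hX s hs (k + 1) hkm
      rw [show I s + 2 * (k + 1) = I s + 2 * k + 2 by ring] at hk2
      have e : I s + 2 * k + 1 + 2 = I s + 2 * k + 2 + 1 := by ring
      rcases hik with rfl | rfl
      · rw [hk1.1, hk2.1]
        exact h.strict _ _ (by omega) (by omega)
      · rw [e, hk1.2, hk2.2]
        exact h.strict _ _ (by omega) (by omega)
    · obtain rfl : k = m s := by omega
      by_cases h2 : ∃ t ∈ X, I t ≤ i + 2 ∧ i + 2 ≤ I t + 2 * m t + 1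
      · obtain ⟨t, ht, hti⟩ := h2
        obtain ⟨ht1, ht2⟩ := (hS t).1 (hX ht)
        have hp := h.I_mod_two hs1.le
        have hp' := h.I_mod_two ht1.le
        have hsuct := h.I_succ t ht1
        have hIt := h.I_le (t + 1) (by omega)
        obtain ⟨l, hl, hil⟩ : ∃ l ≤ m t, i + 2 = I t + 2 * l ∨ i + 2 = I t + 2 * l + 1 :=
          ⟨(i + 2 - I t) / 2, by omega, by omega⟩
        have hl1 := haX X hX t ht l hl
        rcases hik with rfl | rfl
        · rw [hk1.1, show I s + 2 * m s + 2 = I t + 2 * l by omega, hl1.1]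
          exact h.strict _ _ (by omega) (by omega)
        · rw [hk1.2, show I s + 2 * m s + 1 + 2 = I t + 2 * l + 1 by omega, hl1.2]
          exact h.strict _ _ (by omega) (by omega)
      · push Not at h2
        rw [haX' X hX (i + 2) hi fun t ht hti => by have := h2 t ht hti.1; omega]
        rcases hik with rfl | rfl
        · rw [hk1.1, ← hsucc]
          have := h.lt_succ_I (s := s + 1) (by omega) (by omega)
          rwa [show I s + 2 * m s + 2 = I (s + 1) + 1 by omega]
        · rw [hk1.2]
          exact h.strict _ _ (by omega) (by omega)
  · push Not at h1
    rw [haX' X hX i (by omega) fun t ht hti => by have := h1 t ht hti.1; omega]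
    by_cases h2 : ∃ t ∈ X, I t ≤ i + 2 ∧ i + 2 ≤ I t + 2 * m t + 1
    · obtain ⟨t, ht, hti⟩ := h2
      obtain ⟨ht1, ht2⟩ := (hS t).1 (hX ht)
      have hsuct := h.I_succ t ht1
      have hIt := h.I_le (t + 1) (by omega)
      obtain ⟨l, hl, hil⟩ : ∃ l ≤ m t, i + 2 = I t + 2 * l ∨ i + 2 = I t + 2 * l + 1 :=
        ⟨(i + 2 - I t) / 2, by omega, by omega⟩
      have hl1 := haX X hX t ht l hl
      have hti' := h1 t ht
      rcases hil with hil | hil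
      · rw [hil, hl1.1]
        exact h.strict _ _ (by omega) (by omega)
      · obtain rfl : l = 0 := by omega
        rw [hil, hl1.2]
        exact h.lt_I ht1.le (by omega)
    · push Not at h2
      rw [haX' X hX (i + 2) hi fun t ht hti => by have := h2 t ht hti.1; omega]
      exact h.strict _ _ le_rfl hi

theorem exists_exchange_iff (h : IsSpecialSeq N M a I m) (hN : Even N)
    (hS : ∀ s, s ∈ S ↔ s < 2 * M ∧ s % 2 = 1)
    (haX : ∀ X ⊆ S, ∀ s ∈ X, ∀ k ≤ m s,
        aX X (I s + 2 * k) = a (I s + 2 * k + 1)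
        ∧ aX X (I s + 2 * k + 1) = a (I s + 2 * k))
    (haX' : ∀ X ⊆ S, ∀ i ≤ N,
        (∀ s ∈ X, ¬ (I s ≤ i ∧ i ≤ I s + 2 * m s + 1)) → aX X i = a i) (b : ℕ → ℕ) :
    ((∀ i, i + 2 ≤ N → b i < b (i + 2))
      ∧ (Multiset.range (N + 1)).map b = (Multiset.range (N + 1)).map a
      ∧ (Multiset.range (N + 1)).map (fun i => b i + (i + 1) / 2)
          = (Multiset.range (N + 1)).map (fun i => a i + (i + 1) / 2))
    ↔ ∃ X ⊆ S, ∀ i ≤ N, b i = aX X i := by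
  classical
  constructor
  · rintro ⟨hb, hmap, hmap'⟩
    obtain ⟨hb0, hblock⟩ := eq_or_swap_of_map_eq hN h.mono hmap hmap'
    refine ⟨S.filter fun s => b (I s) ≠ a (I s), Finset.filter_subset _ _, fun i hi => ?_⟩
    by_cases hex : ∃ s ∈ S, I s ≤ i ∧ i ≤ I s + 2 * m s + 1
    · obtain ⟨s, hs, hsi⟩ := hex
      obtain ⟨hs1, hs2⟩ := (hS s).1 hs
      obtain ⟨k, hk, hik⟩ : ∃ k ≤ m s, i = I s + 2 * k ∨ i = I s + 2 * k + 1 :=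
        ⟨(i - I s) / 2, by omega, by omega⟩
      obtain ⟨hu1, hu2⟩ := h.uniform_on_interval hb hblock hs1 hs2 hk
      by_cases hne : b (I s) = a (I s)
      · rw [haX' _ (Finset.filter_subset _ _) i hi]
        · rcases hik with rfl | rfl
          · exact (hu1 hne).1
          · exact (hu1 hne).2
        · intro t ht hti
          obtain ⟨htS, hne'⟩ := Finset.mem_filter.1 ht
          obtain ⟨ht1, ht2⟩ := (hS t).1 htS
          obtain rfl := h.eq_of_mem_intervals hs1 hs2 ht1 ht2 hsi hti
          exact hne' hne
      · have hX := haX (S.filter fun s => b (I s) ≠ a (I s)) (Finset.filter_subset _ _) s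
          (Finset.mem_filter.2 ⟨hs, hne⟩) k hk
        rcases hik with rfl | rfl
        · exact (hu2 hne).1.trans hX.1.symm
        · exact (hu2 hne).2.trans hX.2.symm
    · push Not at hex
      rw [haX' _ (Finset.filter_subset _ _) i hi fun s hs hsi => by
        have := hex s (Finset.mem_filter.1 hs).1 hsi.1
        omega]
      rcases Nat.eq_zero_or_pos i with rfl | hpos
      · exact hb0
      obtain ⟨r, hr⟩ := hN
      obtain ⟨p, hp, hpi⟩ : ∃ p, p % 2 = 1 ∧ (i = p ∨ i = p + 1) :=
        ⟨2 * ((i - 1) / 2) + 1, by omega, by omega⟩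
      have hbl := hblock p hp (by omega)
      rcases h.block_cases hp (by omega) with heq | hlt | ⟨s, hs1, hs2, k, hk, rfl⟩
      · rcases hpi with rfl | rfl <;> omega
      · have hpar := h.I_zero_even
        obtain ⟨l, rfl⟩ : ∃ l, p = 2 * l + 1 := ⟨p / 2, by omega⟩
        have := h.eq_before_I_zero hb hb0 hblock (l := l) (by omega)
        rcases hpi with rfl | rfl
        · exact this.2.1
        · exact this.2.2
      · have := hex s ((hS s).2 ⟨hs1, hs2⟩)
        omega
  · rintro ⟨X, hX, hbX⟩
    let P : ℕ → Prop := fun j => ∃ s ∈ X, I s < 2 * j ∧ 2 * j ≤ I s + 2 * m s + 1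
    have hflip : ∀ i ≤ N, b i = a (flipBlocks P i) := fun i hi => by
      rw [hbX i hi, h.exchange_eq_flipBlocks hS haX haX' hX hi]
    refine ⟨fun i hi => ?_, ?_, ?_⟩
    · rw [hbX i (by omega), hbX (i + 2) hi]
      exact h.exchange_strict hS haX haX' hX hi
    · rw [← map_comp_flipBlocks P hN a]
      exact Multiset.map_congr rfl fun i hi =>
        hflip i (Nat.lt_succ_iff.1 (Multiset.mem_range.1 hi))
    · rw [← map_comp_flipBlocks P hN fun i => a i + (i + 1) / 2]
      refine Multiset.map_congr rfl fun i hi => ?_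
      rw [hflip i (Nat.lt_succ_iff.1 (Multiset.mem_range.1 hi)), flipBlocks_block]

end IsSpecialSeq

theorem card_filter_odd_range (M : ℕ) :
    ((Finset.range (2 * M)).filter fun s => s % 2 = 1).card = M := by
  induction M with
  | zero => rfl
  | succ M ih =>
    have h1 : (2 * M) % 2 ≠ 1 := by omega
    have h2 : (2 * M + 1) % 2 = 1 := by omega
    rw [show 2 * (M + 1) = 2 * M + 1 + 1 by ring, Finset.range_add_one, Finset.filter_insert,
      if_pos h2, Finset.range_add_one, Finset.filter_insert, if_neg h1,
      Finset.card_insert_of_notMem (by simp), ih]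

/-- Setup §1: the map `X ↦ a^X` on subsets `X ⊆ {1,3,…,2M-1}` is
injective, and `{b ∈ ℰ : [b̂] = [â]} = {a^X : X ⊆ {1,3,…,2M-1}}`; consequently
the set `{b ∈ ℰ : [b̂] = [â]}` (viewed as a set of tuples of length `N+1`) has
exactly `2^M` elements. -/
theorem stmt_5 (N M : ℕ) (a I m : ℕ → ℕ)
    (hN : Even N)
    (hmono : ∀ i, i + 1 ≤ N → a i ≤ a (i + 1))
    (hstrict : ∀ i, i + 2 ≤ N → a i < a (i + 2))
    (hImono : ∀ s t, s < t → t ≤ 2 * M → I s < I t)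
    (hIJ : ∀ i, (i ≤ N ∧ ((Finset.range (N + 1)).filter fun j => a j = a i).card = 1)
        ↔ ∃ s, s ≤ 2 * M ∧ I s = i)
    (hm : ∀ s, s < 2 * M → I (s + 1) = I s + 2 * m s + 1)
    -- `S = {1,3,…,2M-1}`:
    (S : Finset ℕ) (hS : S = (Finset.range (2 * M)).filter fun s => s % 2 = 1)
    -- `aX X` is the sequence `a^X`, for each `X ⊆ S`:
    (aX : Finset ℕ → ℕ → ℕ)
    (haX : ∀ X ⊆ S, ∀ s ∈ X, ∀ k ≤ m s,
        aX X (I s + 2 * k) = a (I s + 2 * k + 1)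
        ∧ aX X (I s + 2 * k + 1) = a (I s + 2 * k))
    (haX' : ∀ X ⊆ S, ∀ i ≤ N,
        (∀ s ∈ X, ¬ (I s ≤ i ∧ i ≤ I s + 2 * m s + 1)) → aX X i = a i) :
    -- injectivity of `X ↦ a^X`:
    (∀ X ⊆ S, ∀ Y ⊆ S, (∀ i ≤ N, aX X i = aX Y i) → X = Y)
    -- `{b ∈ ℰ : [b̂] = [â]} = {a^X : X ⊆ S}`:
    ∧ (∀ b : ℕ → ℕ,
        ((∀ i, i + 2 ≤ N → b i < b (i + 2))
          ∧ (Multiset.range (N + 1)).map b = (Multiset.range (N + 1)).map a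
          ∧ (Multiset.range (N + 1)).map (fun i => b i + (i + 1) / 2)
              = (Multiset.range (N + 1)).map (fun i => a i + (i + 1) / 2))
        ↔ ∃ X ⊆ S, ∀ i ≤ N, b i = aX X i)
    -- the cardinality of `{b ∈ ℰ : [b̂] = [â]}` is `2^M`:
    ∧ Set.ncard {p : Fin (N + 1) → ℕ |
        (∀ i : ℕ, ∀ h : i + 2 ≤ N, p ⟨i, by omega⟩ < p ⟨i + 2, by omega⟩)
        ∧ Finset.univ.val.map p = Finset.univ.val.map (fun i : Fin (N + 1) => a i)
        ∧ Finset.univ.val.map (fun i : Fin (N + 1) => p i + ((i : ℕ) + 1) / 2)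
            = Finset.univ.val.map (fun i : Fin (N + 1) => a i + ((i : ℕ) + 1) / 2)}
      = 2 ^ M := by
  have hS' : ∀ s, s ∈ S ↔ s < 2 * M ∧ s % 2 = 1 := fun s => by simp [hS]
  have h := isSpecialSeq hmono hstrict hImono hIJ hm
  have hinj := h.exchange_injective hS' haX haX'
  have hiff := h.exists_exchange_iff hN hS' haX haX'
  refine ⟨hinj, hiff, ?_⟩
  have himage : ∀ p : Fin (N + 1) → ℕ,
      ((∀ i : ℕ, ∀ h : i + 2 ≤ N, p ⟨i, by omega⟩ < p ⟨i + 2, by omega⟩)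
        ∧ Finset.univ.val.map p = Finset.univ.val.map (fun i : Fin (N + 1) => a i)
        ∧ Finset.univ.val.map (fun i : Fin (N + 1) => p i + ((i : ℕ) + 1) / 2)
            = Finset.univ.val.map (fun i : Fin (N + 1) => a i + ((i : ℕ) + 1) / 2))
      ↔ ∃ X ∈ S.powerset, (fun i : Fin (N + 1) => aX X i) = p := by
    intro p
    obtain ⟨b, rfl⟩ : ∃ b : ℕ → ℕ, p = fun i : Fin (N + 1) => b i :=
      ⟨fun i => if hi : i < N + 1 then p ⟨i, hi⟩ else 0, by ext i; simp [i.2]⟩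
    rw [Fin.univ_val_map_natCast, Fin.univ_val_map_natCast,
      Fin.univ_val_map_natCast _ fun i => b i + (i + 1) / 2,
      Fin.univ_val_map_natCast _ fun i => a i + (i + 1) / 2, hiff b]
    simp only [Finset.mem_powerset, funext_iff]
    exact exists_congr fun X => and_congr_right fun _ =>
      ⟨fun hb i => (hb i (by omega)).symm, fun hb i hi => (hb ⟨i, by omega⟩).symm⟩
  have hset : {p : Fin (N + 1) → ℕ |
        (∀ i : ℕ, ∀ h : i + 2 ≤ N, p ⟨i, by omega⟩ < p ⟨i + 2, by omega⟩)
        ∧ Finset.univ.val.map p = Finset.univ.val.map (fun i : Fin (N + 1) => a i)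
        ∧ Finset.univ.val.map (fun i : Fin (N + 1) => p i + ((i : ℕ) + 1) / 2)
            = Finset.univ.val.map (fun i : Fin (N + 1) => a i + ((i : ℕ) + 1) / 2)}
      = Set.image (fun (X : Finset ℕ) (i : Fin (N + 1)) => aX X i) (S.powerset : Set (Finset ℕ)) :=
    Set.ext himage
  rw [hset, Set.InjOn.ncard_image, Set.ncard_coe_finset, Finset.card_powerset, hS,
    card_filter_odd_range]
  intro X hX Y hY hXY
  exact hinj X (Finset.mem_powerset.1 hX) Y (Finset.mem_powerset.1 hY) fun i hi =>
    congrFun hXY ⟨i, by omega⟩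
end

section
/- Let a_0 ≤ a_1 ≤ … ≤ a_N be natural numbers in which each value occurs at most twice; let S be the set of values occurring exactly once and D the set of values occurring exactly twice, and assume S ≠ ∅. Let 𝔗 be the set of unordered pairs {𝔄,𝔅} of subsets of ℕ such that 𝔄 ⊔ 𝔅 equals the multiset {a_0,…,a_N}. Then the map 𝒫(S) → 𝔗 sending 𝔰 ⊆ S to the unordered pair {D ∪ 𝔰, D ∪ (S∖𝔰)} is surjective; two subsets 𝔰, 𝔰' of S have the same image if and only if 𝔰' = 𝔰 or 𝔰' = S∖𝔰; hence the map induces a bijection from 𝒫(S)/{∅,S} onto 𝔗, and |𝔗| = 2^{|S|−1}. -/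
/-- The multiset sum of two finsets equals `M`, whose elements have multiplicity one on `S` and
two on `D`, exactly when both contain `D` and they split `S` between them. -/
theorem Finset.val_add_val_eq_iff_exists_subset {α : Type*} [DecidableEq α] {M : Multiset α}
    {S D : Finset α} (hM : ∀ v, M.count v ≤ 2) (hS : ∀ v, v ∈ S ↔ M.count v = 1)
    (hD : ∀ v, v ∈ D ↔ M.count v = 2) (A B : Finset α) :
    A.val + B.val = M ↔ ∃ t ⊆ S, A = D ∪ t ∧ B = D ∪ (S \ t) := by
  have hcount (C : Finset α) (v : α) : C.val.count v = if v ∈ C then 1 else 0 :=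
    Multiset.count_eq_of_nodup C.nodup
  simp only [Multiset.ext, Multiset.count_add, hcount]
  constructor
  · intro h
    refine ⟨A ∩ S, Finset.inter_subset_right, ?_, ?_⟩ <;>
    · ext v
      have := h v
      simp only [Finset.mem_union, Finset.mem_sdiff, Finset.mem_inter, hS, hD]
      grind
  · rintro ⟨t, ht, rfl, rfl⟩ v
    have := @ht v
    have := hM v
    simp only [Finset.mem_union, Finset.mem_sdiff]
    grind

/-- Adjoining a disjoint set to both halves of a splitting of `S` loses nothing but the order of
the halves. -/
theorem Finset.sym2_union_union_sdiff_eq_iff {α : Type*} [DecidableEq α] {S D t t' : Finset α}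
    (hSD : Disjoint S D) (ht : t ⊆ S) (ht' : t' ⊆ S) :
    s(D ∪ t, D ∪ (S \ t)) = s(D ∪ t', D ∪ (S \ t')) ↔ t' = t ∨ t' = S \ t := by
  have cancel {u w : Finset α} (hu : u ⊆ S) (hw : w ⊆ S) (h : D ∪ u = D ∪ w) : u = w := by
    rw [← Finset.union_sdiff_cancel_left (hSD.symm.mono_right hu), h,
      Finset.union_sdiff_cancel_left (hSD.symm.mono_right hw)]
  rw [Sym2.eq_iff]
  constructor
  · rintro (⟨h, -⟩ | ⟨-, h⟩)
    · exact .inl (cancel ht ht' h).symm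
    · exact .inr (cancel Finset.sdiff_subset ht' h).symm
  · rintro (rfl | rfl)
    · simp
    · simp [Finset.inter_eq_right.mpr ht]

/-- A map on the subsets of a nonempty `S` that identifies exactly complementary subsets has
`2 ^ (#S - 1)` values. -/
theorem Finset.ncard_image_powerset_of_eq_iff {α β : Type*} [DecidableEq α] {S : Finset α}
    (hS : S.Nonempty) {f : Finset α → β}
    (hf : ∀ t ⊆ S, ∀ t' ⊆ S, (f t = f t' ↔ t' = t ∨ t' = S \ t)) :
    (f '' {t | t ⊆ S}).ncard = 2 ^ (S.card - 1) := by
  obtain ⟨x, hx⟩ := hS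
  have himage : f '' {t | t ⊆ S} = f '' ((S.erase x).powerset : Set (Finset α)) := by
    apply subset_antisymm
    · rintro _ ⟨t, ht, rfl⟩
      by_cases hxt : x ∈ t
      · refine ⟨S \ t, ?_, ((hf t ht _ Finset.sdiff_subset).mpr (.inr rfl)).symm⟩
        exact Finset.mem_powerset.mpr (Finset.subset_erase.mpr ⟨Finset.sdiff_subset, by simp [hxt]⟩)
      · exact ⟨t, Finset.mem_powerset.mpr (Finset.subset_erase.mpr ⟨ht, hxt⟩), rfl⟩
    · refine Set.image_mono fun t ht => ?_
      exact (Finset.mem_powerset.mp ht).trans (Finset.erase_subset x S)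
  have hinj : Set.InjOn f ((S.erase x).powerset : Set (Finset α)) := by
    intro t ht t' ht' h
    simp only [Finset.coe_powerset, Set.mem_preimage, Set.mem_powerset_iff, Finset.coe_subset,
      Finset.subset_erase] at ht ht'
    rcases (hf t ht.1 t' ht'.1).mp h with rfl | rfl
    · rfl
    · simp [hx, ht.2] at ht'
  rw [himage, hinj.ncard_image, Set.ncard_coe_finset, Finset.card_powerset,
    Finset.card_erase_of_mem hx]


/-- Let `a_0 ≤ … ≤ a_N` be natural numbers in which each value occurs
at most twice; let `S` be the set of values occurring exactly once and `D` the set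
of values occurring exactly twice, with `S ≠ ∅`.  Let `𝔗` be the set of unordered
pairs `{𝔄,𝔅}` of subsets of `ℕ` with `𝔄 ⊔ 𝔅 = {a_0,…,a_N}` as multisets.  Then the
map `𝔰 ↦ {D ∪ 𝔰, D ∪ (S∖𝔰)}` maps `𝒫(S)` into `𝔗` and is surjective onto `𝔗`;
two subsets `𝔰, 𝔰' ⊆ S` have the same image iff `𝔰' = 𝔰` or `𝔰' = S∖𝔰` (so it
induces a bijection `𝒫(S)/{∅,S} ≃ 𝔗`); and `|𝔗| = 2^(|S|-1)`. -/
theorem stmt_6 (N : ℕ) (a : ℕ → ℕ)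
    (hmono : ∀ i, i + 1 ≤ N → a i ≤ a (i + 1))
    (htwice : ∀ v, ((Finset.range (N + 1)).filter fun i => a i = v).card ≤ 2)
    (S D : Finset ℕ)
    (hSdef : ∀ v, v ∈ S ↔ ((Finset.range (N + 1)).filter fun i => a i = v).card = 1)
    (hDdef : ∀ v, v ∈ D ↔ ((Finset.range (N + 1)).filter fun i => a i = v).card = 2)
    (hSne : S.Nonempty)
    (𝔗 : Set (Sym2 (Finset ℕ)))
    (h𝔗 : 𝔗 = {z | ∃ A B : Finset ℕ, z = s(A, B)
        ∧ A.val + B.val = (Multiset.range (N + 1)).map a}) :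
    -- the map sends `𝒫(S)` into `𝔗`:
    (∀ t ⊆ S, s(D ∪ t, D ∪ (S \ t)) ∈ 𝔗)
    -- surjectivity onto `𝔗`:
    ∧ (∀ z ∈ 𝔗, ∃ t ⊆ S, s(D ∪ t, D ∪ (S \ t)) = z)
    -- fibers: same image iff `𝔰' = 𝔰` or `𝔰' = S ∖ 𝔰`:
    ∧ (∀ t ⊆ S, ∀ t' ⊆ S,
        (s(D ∪ t, D ∪ (S \ t)) = s(D ∪ t', D ∪ (S \ t')) ↔ (t' = t ∨ t' = S \ t)))
    -- `|𝔗| = 2^(|S|-1)`: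
    ∧ 𝔗.ncard = 2 ^ (S.card - 1) := by
  have hcount (v : ℕ) : ((Multiset.range (N + 1)).map a).count v =
      ((Finset.range (N + 1)).filter fun i => a i = v).card := by
    simp only [Multiset.count_map, Finset.card_def, Finset.filter_val, Finset.range_val, eq_comm]
  have hmem := Finset.val_add_val_eq_iff_exists_subset
    (M := (Multiset.range (N + 1)).map a) (by simpa only [hcount] using htwice)
    (by simpa only [hcount] using hSdef) (by simpa only [hcount] using hDdef)
  have hSD : Disjoint S D := Finset.disjoint_left.mpr fun v hS hD => by
    have := (hSdef v).mp hS
    have := (hDdef v).mp hD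
    omega
  have hfiber : ∀ t ⊆ S, ∀ t' ⊆ S,
      (s(D ∪ t, D ∪ (S \ t)) = s(D ∪ t', D ∪ (S \ t')) ↔ (t' = t ∨ t' = S \ t)) :=
    fun t ht t' ht' => Finset.sym2_union_union_sdiff_eq_iff hSD ht ht'
  have himage : 𝔗 = (fun t => s(D ∪ t, D ∪ (S \ t))) '' {t | t ⊆ S} := by
    rw [h𝔗]
    ext z
    simp only [hmem]
    constructor
    · rintro ⟨_, _, rfl, t, ht, rfl, rfl⟩
      exact ⟨t, ht, rfl⟩
    · rintro ⟨t, ht, rfl⟩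
      exact ⟨_, _, rfl, t, ht, rfl, rfl⟩
  refine ⟨fun t ht => himage ▸ ⟨t, ht, rfl⟩, fun z hz => ?_, hfiber, ?_⟩
  · rwa [himage] at hz
  · rw [himage]
    exact Finset.ncard_image_powerset_of_eq_iff hSne hfiber
end

section
/- Let 𝒳 be a nonempty finite set. Regard 𝒫(𝒳) as an 𝔽₂-vector space under symmetric difference, let 𝒫_{ev}(𝒳) be the subspace of even-cardinality subsets, and let 𝒫̄_{ev}(𝒳) be the image of 𝒫_{ev}(𝒳) in the quotient 𝒫̄(𝒳) = 𝒫(𝒳)/{∅,𝒳}. Then: (i) the assignment β(L,L') = |L∩L'| mod 2 is an 𝔽₂-bilinear alternating form on 𝒫_{ev}(𝒳) (bilinear with respect to symmetric difference, and β(L,L) = 0 for all L ∈ 𝒫_{ev}(𝒳)); (ii) β descends to a well-defined form (,) on 𝒫̄_{ev}(𝒳); and (iii) the induced form (,) on 𝒫̄_{ev}(𝒳) is nondegenerate. -/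
/-- Modulo two, the cardinality of a symmetric difference is the sum of the cardinalities. -/
theorem Finset.natCast_card_symmDiff {α : Type*} [DecidableEq α] (s t : Finset α) :
    ((symmDiff s t).card : ZMod 2) = s.card + t.card := by
  have h₁ : (symmDiff s t).card = (s \ t).card + (t \ s).card :=
    Finset.card_union_of_disjoint disjoint_sdiff_sdiff
  have h₂ := Finset.card_sdiff_add_card_inter s t
  have h₃ := Finset.card_sdiff_add_card_inter t s
  rw [Finset.inter_comm] at h₃
  rw [← Nat.cast_add, ZMod.natCast_eq_natCast_iff, Nat.ModEq]
  omega


/-- Let `𝒳` be a nonempty finite set, `𝒫(𝒳)` its power set regarded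
as an 𝔽₂-vector space under symmetric difference, `𝒫_ev(𝒳)` the subspace of
even-cardinality subsets, and `𝒫̄_ev(𝒳)` its image in `𝒫̄(𝒳) = 𝒫(𝒳)/{∅,𝒳}`.
For `β(L,L') = |L ∩ L'| mod 2`:
(i) `β` is 𝔽₂-bilinear (additive in each variable w.r.t. symmetric difference)
and alternating on `𝒫_ev(𝒳)` (`β(L,L) = 0` for even `L`);
(ii) `β` descends to a well-defined form on `𝒫̄_ev(𝒳)` (it is unchanged when
either even argument is replaced by its complement);
(iii) the induced form on `𝒫̄_ev(𝒳)` is nondegenerate (an even set pairing to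
zero with every even set is `∅` or `𝒳`). -/
theorem stmt_8 (X : Type*) [Fintype X] [DecidableEq X] [Nonempty X]
    (β : Finset X → Finset X → ZMod 2)
    (hβ : ∀ L L', β L L' = ((L ∩ L').card : ZMod 2)) :
    -- (i) bilinearity with respect to symmetric difference:
    (∀ L L' M : Finset X, β (symmDiff L L') M = β L M + β L' M)
    ∧ (∀ L M M' : Finset X, β L (symmDiff M M') = β L M + β L M')
    -- (i) alternating on `𝒫_ev(𝒳)`:
    ∧ (∀ L : Finset X, Even L.card → β L L = 0)
    -- (ii) well defined on cosets of `{∅,𝒳}`: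
    ∧ (∀ L L' : Finset X, Even L.card → Even L'.card →
        β (symmDiff L Finset.univ) L' = β L L' ∧ β L (symmDiff L' Finset.univ) = β L L')
    -- (iii) nondegeneracy of the induced form on `𝒫̄_ev(𝒳)`:
    ∧ (∀ L : Finset X, Even L.card →
        (∀ L' : Finset X, Even L'.card → β L L' = 0) → L = ∅ ∨ L = Finset.univ) := by
  have even_iff (L : Finset X) : (L.card : ZMod 2) = 0 ↔ Even L.card :=
    ZMod.natCast_eq_zero_iff_even
  have add_left (L L' M : Finset X) : β (symmDiff L L') M = β L M + β L' M := by
    simp only [hβ, ← Finset.natCast_card_symmDiff]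
    congr 2
    exact inf_symmDiff_distrib_right L L' M
  have comm (L M : Finset X) : β L M = β M L := by
    rw [hβ, hβ, Finset.inter_comm]
  have univ_left (L : Finset X) (hL : Even L.card) : β Finset.univ L = 0 := by
    rw [hβ, Finset.univ_inter, even_iff]
    exact hL
  refine ⟨add_left, fun L M M' => ?_, fun L hL => ?_, fun L L' hL hL' => ⟨?_, ?_⟩,
    fun L _ h => ?_⟩
  · rw [comm, add_left, comm M, comm M']
  · rw [hβ, Finset.inter_self, even_iff]
    exact hL
  · rw [add_left, univ_left L' hL', add_zero]
  · rw [comm, add_left, univ_left L hL, add_zero, comm]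
  · by_contra! hne
    obtain ⟨⟨a, ha⟩, hL⟩ := hne
    obtain ⟨b, hb⟩ : ∃ b, b ∉ L := by
      simpa [Finset.eq_univ_iff_forall] using hL
    have hab : a ≠ b := fun hab => hb (hab ▸ ha)
    have hpair := h {a, b} (by simp [Finset.card_pair hab])
    have hinter : L ∩ {a, b} = {a} := by
      ext x
      simp only [Finset.mem_inter, Finset.mem_insert, Finset.mem_singleton]
      grind
    simp [hβ, hinter] at hpair
end
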